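/- arXiv:1803.05703 — 2 statements merged into one kernel-verified Lean document; each statement's English description precedes it below -/
import Mathlib

section
/- Let ψ: ℕ → ℝ be a non-negative function and suppose there exists a constant ε > 0 such that the series ∑_{n=1}^∞ ψ(n)·φ(n)/(n·(log n)^ε) diverges. Then λ(W(ψ)) = 1, i.e. almost every point of the circle lies in infinitely many of the sets E_n(ψ). -/
open MeasureTheory Filter Finset

/-- The set `E_n(ψ) ⊆ ℝ/ℤ`, the union over `1 ≤ a ≤ n`, `gcd(a,n)=1`, of the
intervals `((a-ψ(n))/n, (a+ψ(n))/n)` taken mod 1. -/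
noncomputable def E (ψ : ℕ → ℝ) (n : ℕ) : Set UnitAddCircle :=
  ⋃ a ∈ (Finset.Icc 1 n).filter (fun a => Nat.Coprime a n),
    (fun y : ℝ => (y : UnitAddCircle)) '' Set.Ioo (((a : ℝ) - ψ n) / n) (((a : ℝ) + ψ n) / n)

/-- `W(ψ)`: points of the circle lying in infinitely many sets `E_n(ψ)`. -/
noncomputable def W (ψ : ℕ → ℝ) : Set UnitAddCircle := {x | ∃ᶠ n in atTop, x ∈ E ψ n}

/-- `log x` understood as `max (1, log x)`. -/
noncomputable def flog (x : ℝ) : ℝ := max 1 (Real.log x)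


open ArithmeticFunction in
lemma ds_sumLambda (n : ℕ) (hn : 1 ≤ n) :
    ∑ d ∈ Icc 1 n, Λ d / d ≤ Real.log n + (Real.log 4 + 4) := by
  have hn0 : (0:ℝ) < n := by exact_mod_cast hn
  have h1 : ∑ m ∈ Icc 1 n, Real.log m = ∑ d ∈ Icc 1 n, Λ d * ((n / d : ℕ) : ℝ) := by
    have : ∀ m ∈ Icc 1 n, Real.log m = ∑ d ∈ Icc 1 n, if d ∣ m then Λ d else 0 := by
      intro m hm
      rw [mem_Icc] at hm
      rw [← vonMangoldt_sum, ← Finset.sum_filter]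
      apply Finset.sum_congr _ (fun _ _ => rfl)
      ext d
      simp only [Nat.mem_divisors, mem_filter, mem_Icc]
      constructor
      · rintro ⟨h, h'⟩
        exact ⟨⟨Nat.pos_of_dvd_of_pos h (by omega), (Nat.le_of_dvd (by omega) h).trans hm.2⟩, h⟩
      · rintro ⟨_, h⟩
        exact ⟨h, by omega⟩
    rw [Finset.sum_congr rfl this, Finset.sum_comm]
    apply Finset.sum_congr rfl
    intro d hd
    rw [← Finset.sum_filter, Finset.sum_const, nsmul_eq_mul, mul_comm]
    congr 2
    have := Nat.Ioc_filter_dvd_card_eq_div n d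
    rw [← this]
    congr 1
  have h2 : ∑ m ∈ Icc 1 n, Real.log m ≤ n * Real.log n := by
    calc _ ≤ ∑ m ∈ Icc 1 n, Real.log n := by
          apply Finset.sum_le_sum
          intro m hm
          rw [mem_Icc] at hm
          apply Real.log_le_log
          · exact_mod_cast hm.1
          · exact_mod_cast hm.2
      _ = _ := by simp
  have h3 : ∑ d ∈ Icc 1 n, Λ d ≤ (Real.log 4 + 4) * n := by
    have := Chebyshev.psi_le_const_mul_self (x := n) hn0.le
    rw [Chebyshev.psi] at this
    rw [Nat.floor_natCast] at this
    exact this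
  have h4 : ∑ d ∈ Icc 1 n, Λ d / d * n ≤ ∑ d ∈ Icc 1 n, (Λ d * ((n / d : ℕ) : ℝ) + Λ d) := by
    apply Finset.sum_le_sum
    intro d hd
    rw [mem_Icc] at hd
    have hd0 : (0:ℝ) < d := by exact_mod_cast hd.1
    have : (n:ℝ) / d ≤ ((n / d : ℕ) : ℝ) + 1 := by
      rw [← Nat.floor_div_eq_div (K := ℝ)]
      exact (Nat.lt_floor_add_one _).le
    calc Λ d / d * n = Λ d * (n / d) := by ring
      _ ≤ Λ d * (((n / d : ℕ) : ℝ) + 1) := mul_le_mul_of_nonneg_left this vonMangoldt_nonneg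
      _ = _ := by ring
  rw [Finset.sum_add_distrib, ← h1, ← Finset.sum_mul] at h4
  have : (∑ d ∈ Icc 1 n, Λ d / d) * n ≤ (Real.log n + (Real.log 4 + 4)) * n := by linarith
  exact le_of_mul_le_mul_right this hn0

open ArithmeticFunction in
lemma ds_sumLogP (n : ℕ) (hn : 1 ≤ n) :
    ∑ p ∈ (Icc 1 n).filter Nat.Prime, Real.log p / p ≤ Real.log n + (Real.log 4 + 4) := by
  refine le_trans ?_ (ds_sumLambda n hn)
  calc _ = ∑ p ∈ (Icc 1 n).filter Nat.Prime, Λ p / p := by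
        apply Finset.sum_congr rfl
        intro p hp
        rw [vonMangoldt_apply_prime (mem_filter.1 hp).2]
    _ ≤ _ := by
        apply Finset.sum_le_sum_of_subset_of_nonneg (filter_subset _ _)
        intros
        exact div_nonneg vonMangoldt_nonneg (by positivity)

lemma ds_mertens_aux (n : ℕ) (hn : 2 ≤ n) :
    ∑ p ∈ (Icc 1 n).filter Nat.Prime, 1 / (p:ℝ) +
      (Real.log n + (Real.log 4 + 4) - ∑ p ∈ (Icc 1 n).filter Nat.Prime, Real.log p / p) / Real.log n
      ≤ Real.log (Real.log n) + (1 + (Real.log 4 + 4) / Real.log 2 - Real.log (Real.log 2)) := by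
  induction n, hn using Nat.le_induction with
  | base =>
    have : (Icc 1 2).filter Nat.Prime = {2} := by decide
    rw [this]
    have h2 : 0 < Real.log 2 := Real.log_pos (by norm_num)
    simp only [sum_singleton, Nat.cast_ofNat]
    apply le_of_eq
    field_simp
    ring
  | succ n hn ih =>
    have hS := ds_sumLogP n (by omega)
    have hl : 0 < Real.log n := Real.log_pos (by exact_mod_cast hn)
    have hl1 : Real.log n < Real.log (n+1:ℕ) := Real.log_lt_log (by positivity) (by push_cast; linarith)
    have hl' := hl.trans hl1
    have hkey : (Real.log (n+1:ℕ) - Real.log n) / Real.log (n+1:ℕ) ≤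
        Real.log (Real.log (n+1:ℕ)) - Real.log (Real.log n) := by
      have := Real.log_le_sub_one_of_pos (div_pos hl hl')
      rw [Real.log_div hl.ne' hl'.ne'] at this
      have e : (Real.log (n+1:ℕ) - Real.log n) / Real.log (n+1:ℕ) = 1 - Real.log n / Real.log (n+1:ℕ) := by
        field_simp
      linarith
    have hins : (Icc 1 (n+1)).filter Nat.Prime = if (n+1).Prime then insert (n+1) ((Icc 1 n).filter Nat.Prime) else (Icc 1 n).filter Nat.Prime := by
      rw [← Finset.insert_Icc_right_eq_Icc_add_one (by omega), filter_insert]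
    have hR : ∀ R : ℝ, 0 ≤ R → R / Real.log (n+1:ℕ) ≤ R / Real.log n := fun R hR =>
      div_le_div_of_nonneg_left hR hl hl1.le
    set s := ∑ p ∈ (Icc 1 n).filter Nat.Prime, 1 / (p:ℝ)
    set S := ∑ p ∈ (Icc 1 n).filter Nat.Prime, Real.log p / p
    have h5 := hR (Real.log n + (Real.log 4 + 4) - S) (by linarith)
    rw [hins]
    have h6 : s + (Real.log (n+1:ℕ) + (Real.log 4 + 4) - S) / Real.log (n+1:ℕ) ≤ Real.log (Real.log (n+1:ℕ)) + (1 + (Real.log 4 + 4) / Real.log 2 - Real.log (Real.log 2)) := by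
      have : (Real.log (n+1:ℕ) + (Real.log 4 + 4) - S) / Real.log (n+1:ℕ) =
        (Real.log n + (Real.log 4 + 4) - S) / Real.log (n+1:ℕ) + (Real.log (n+1:ℕ) - Real.log n) / Real.log (n+1:ℕ) := by ring
      linarith
    split_ifs with hp
    · rw [sum_insert (by simp), sum_insert (by simp)]
      refine le_trans (le_of_eq ?_) h6
      have : ((n+1:ℕ):ℝ) ≠ 0 := by positivity
      field_simp
      ring
    · exact h6

lemma ds_mertens : ∃ C : ℝ, ∀ n : ℕ, 2 ≤ n →
    ∑ p ∈ (Icc 1 n).filter Nat.Prime, 1 / (p:ℝ) ≤ Real.log (Real.log n) + C := by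
  refine ⟨_, fun n hn => le_trans ?_ (ds_mertens_aux n hn)⟩
  have hS := ds_sumLogP n (by omega)
  have hl : 0 < Real.log n := Real.log_pos (by exact_mod_cast hn)
  have : 0 ≤ (Real.log n + (Real.log 4 + 4) - ∑ p ∈ (Icc 1 n).filter Nat.Prime, Real.log p / p) / Real.log n := div_nonneg (by linarith) hl.le
  linarith

lemma ds_prod : ∃ C : ℝ, 0 < C ∧ ∀ n : ℕ, 2 ≤ n →
    ∏ p ∈ (Icc 1 n).filter Nat.Prime, (1 + (p:ℝ) / (p-1)^2) ≤ C * Real.log n := by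
  obtain ⟨C, hC⟩ := ds_mertens
  have hsum : Summable (fun p : ℕ => 8 / (p:ℝ)^2) := by
    have := (Real.summable_one_div_nat_pow (p := 2)).2 (by norm_num)
    simpa [div_eq_mul_inv] using this.mul_left 8
  refine ⟨Real.exp (C + ∑' p : ℕ, 8 / (p:ℝ)^2), Real.exp_pos _, fun n hn => ?_⟩
  have hl : 0 < Real.log n := Real.log_pos (by exact_mod_cast hn)
  calc _ ≤ ∏ p ∈ (Icc 1 n).filter Nat.Prime, Real.exp (1 / (p:ℝ) + 8 / (p:ℝ)^2) := by
        apply Finset.prod_le_prod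
        · intros; positivity
        · intro p hp
          have hp2 : (2:ℝ) ≤ p := by exact_mod_cast (mem_filter.1 hp).2.two_le
          refine le_trans ?_ (Real.add_one_le_exp _)
          rw [add_comm]
          gcongr
          rw [div_le_iff₀ (by nlinarith), ← sub_nonneg]
          have : (1 / (p:ℝ) + 8 / (p:ℝ)^2) * (p-1)^2 - p = (6 * p^2 - 15 * p + 8) / p^2 := by
            field_simp; ring
          rw [this]
          apply div_nonneg _ (by positivity)
          nlinarith
    _ = Real.exp (∑ p ∈ (Icc 1 n).filter Nat.Prime, 1 / (p:ℝ) + ∑ p ∈ (Icc 1 n).filter Nat.Prime, 8 / (p:ℝ)^2) := by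
        rw [← Real.exp_sum, sum_add_distrib]
    _ ≤ Real.exp ((Real.log (Real.log n) + C) + ∑' p : ℕ, 8 / (p:ℝ)^2) := by
        gcongr
        · exact hC n hn
        · exact hsum.sum_le_tsum _ (fun _ _ => by positivity)
    _ = _ := by
        rw [add_assoc, Real.exp_add, Real.exp_log hl]; ring


noncomputable def dsS (N X : ℕ) : ℝ := ∑ c ∈ (Icc 1 X).filter (fun c => Nat.Coprime c N), 1 / (Nat.totient c : ℝ)

lemma dsS_nonneg (N X : ℕ) : 0 ≤ dsS N X := sum_nonneg (fun _ _ => by positivity)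

lemma dsS_mono (N : ℕ) {X Y : ℕ} (h : X ≤ Y) : dsS N X ≤ dsS N Y := by
  apply sum_le_sum_of_subset_of_nonneg
  · exact filter_subset_filter _ (Icc_subset_Icc_right h)
  · intros; positivity

lemma dsS_le_prod (N X : ℕ) : dsS N X ≤
    ∏ p ∈ (Icc 1 X).filter (fun p => Nat.Prime p ∧ ¬ p ∣ N), (1 + (p:ℝ) / (p-1)^2) := by
  set f : ℕ → ℝ := fun c => if Nat.Coprime c N then 1 / (Nat.totient c : ℝ) else 0 with hf
  have f0 : ∀ c, 0 ≤ f c := by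
    intro c; simp only [hf]; split_ifs <;> positivity
  have f1 : f 1 = 1 := by simp [hf]
  have fm : ∀ {m n : ℕ}, Nat.Coprime m n → f (m * n) = f m * f n := by
    intro m n h
    simp only [hf, Nat.coprime_mul_iff_left, Nat.totient_mul h]
    by_cases h1 : Nat.Coprime m N
    · by_cases h2 : Nat.Coprime n N
      · rw [if_pos ⟨h1, h2⟩, if_pos h1, if_pos h2]; push_cast; rw [one_div_mul_one_div]
      · rw [if_neg (fun h => h2 h.2), if_neg h2, mul_zero]
    · rw [if_neg (fun h => h1 h.1), if_neg h1, zero_mul]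
  have hdiv : ∀ p : ℕ, p.Prime → p ∣ N → HasSum (fun n : ℕ => f (p^n)) 1 := by
    intro p hp hd
    have : (fun n : ℕ => f (p^n)) = fun n => if n = 0 then 1 else 0 := by
      funext n
      rcases Nat.eq_zero_or_pos n with rfl | h
      · simp [f1]
      · have : ¬ Nat.Coprime (p^n) N := by
          rw [Nat.coprime_pow_left_iff h, hp.coprime_iff_not_dvd]; simpa
        simp [hf, this, h.ne']
    rw [this]
    exact hasSum_ite_eq 0 1
  have hndiv : ∀ p : ℕ, p.Prime → ¬ p ∣ N → HasSum (fun n : ℕ => f (p^n)) (1 + (p:ℝ) / (p-1)^2) := by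
    intro p hp hd
    have hp2 : (2:ℝ) ≤ p := by exact_mod_cast hp.two_le
    rw [← hasSum_nat_add_iff' 1]
    have : (fun n : ℕ => f (p^(n+1))) = fun n => (1/((p:ℝ)-1)) * ((p:ℝ)⁻¹)^n := by
      funext n
      have : Nat.Coprime (p^(n+1)) N := by
        rw [Nat.coprime_pow_left_iff (by omega), hp.coprime_iff_not_dvd]; exact hd
      simp only [hf]
      rw [if_pos this, Nat.totient_prime_pow_succ hp]
      push_cast [hp.one_le]
      rw [inv_pow]
      field_simp
    rw [this]
    have h := (hasSum_geometric_of_lt_one (r := (p:ℝ)⁻¹) (by positivity) (by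
      apply inv_lt_one_of_one_lt₀; linarith)).mul_left (1/((p:ℝ)-1))
    convert! h using 1
    simp [f1]
    have : (p:ℝ) - 1 ≠ 0 := by linarith
    have h3 : (1:ℝ) - (p:ℝ)⁻¹ = (p-1)/p := by field_simp
    rw [h3]
    field_simp
  have hs : ∀ {p : ℕ}, p.Prime → Summable (fun n : ℕ => ‖f (p^n)‖) := by
    intro p hp
    have : (fun n : ℕ => ‖f (p^n)‖) = fun n => f (p^n) := by
      funext n; rw [Real.norm_of_nonneg (f0 _)]
    rw [this]
    by_cases h : p ∣ N
    · exact (hdiv p hp h).summable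
    · exact (hndiv p hp h).summable
  obtain ⟨_, h2⟩ := EulerProduct.summable_and_hasSum_smoothNumbers_prod_primesBelow_tsum f1 fm hs (X+1)
  have h3 : ∏ p ∈ (X+1).primesBelow, ∑' n : ℕ, f (p^n) = ∏ p ∈ (Icc 1 X).filter (fun p => Nat.Prime p ∧ ¬ p ∣ N), (1 + (p:ℝ) / (p-1)^2) := by
    symm
    have hsub : (Icc 1 X).filter (fun p => Nat.Prime p ∧ ¬ p ∣ N) ⊆ (X+1).primesBelow := by
      intro p hp
      simp only [mem_filter, mem_Icc] at hp
      rw [Nat.mem_primesBelow]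
      exact ⟨by omega, hp.2.1⟩
    calc _ = ∏ p ∈ (Icc 1 X).filter (fun p => Nat.Prime p ∧ ¬ p ∣ N), ∑' n : ℕ, f (p^n) := by
          apply prod_congr rfl
          intro p hp
          simp only [mem_filter, mem_Icc] at hp
          rw [(hndiv p hp.2.1 hp.2.2).tsum_eq]
      _ = _ := by
          apply prod_subset hsub
          intro p hp hp'
          rw [Nat.mem_primesBelow] at hp
          simp only [mem_filter, mem_Icc, not_and, not_not] at hp'
          rw [(hdiv p hp.2 (hp' ⟨hp.2.one_le, by omega⟩ hp.2)).tsum_eq]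
  rw [← h3]
  have h4 : dsS N X = ∑ c ∈ Icc 1 X, f c := by
    rw [dsS, sum_filter]
  rw [h4]
  classical
  have h5 : ∑ c ∈ Icc 1 X, f c = ∑ m ∈ (Icc 1 X).subtype (· ∈ (X+1).smoothNumbers), f m := by
    rw [Finset.sum_subtype_eq_sum_filter]
    rw [filter_true_of_mem]
    intro c hc
    rw [mem_Icc] at hc
    exact Nat.mem_smoothNumbers_of_lt (by omega) (by omega)
  rw [h5]
  exact sum_le_hasSum _ (fun i _ => f0 _) h2

lemma ds_tot (N : ℕ) (hN : 1 ≤ N) : (N:ℝ) / Nat.totient N = ∏ p ∈ N.primeFactors, ((p:ℝ) / (p-1)) := by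
  have h := Nat.totient_mul_prod_primeFactors N
  have h' : (Nat.totient N : ℝ) * ∏ p ∈ N.primeFactors, (p:ℝ) = N * ∏ p ∈ N.primeFactors, ((p:ℝ)-1) := by
    have := congrArg (Nat.cast (R := ℝ)) h
    push_cast at this
    rw [this]
    congr 1
    apply prod_congr rfl
    intro p hp
    rw [Nat.cast_sub (Nat.prime_of_mem_primeFactors hp).one_le]; simp
  rw [prod_div_distrib]
  have h1 : (Nat.totient N : ℝ) ≠ 0 := by
    have := Nat.totient_pos.2 hN
    positivity
  have h2 : ∏ p ∈ N.primeFactors, ((p:ℝ)-1) ≠ 0 := by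
    rw [prod_ne_zero_iff]
    intro p hp
    have : (2:ℝ) ≤ p := by exact_mod_cast (Nat.prime_of_mem_primeFactors hp).two_le
    linarith
  rw [div_eq_div_iff h1 h2, ← h']
  ring

lemma ds_L4 : ∃ C : ℝ, 0 < C ∧ ∀ N X : ℕ, 1 ≤ N → 2 ≤ X → N ≤ 2^X →
    (N:ℝ) / Nat.totient N * dsS N X ≤ C * Real.log X := by
  obtain ⟨C, hC0, hC⟩ := ds_prod
  refine ⟨C * Real.exp 1, by positivity, fun N X hN hX hNX => ?_⟩
  have hcard : N.primeFactors.card ≤ X := by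
    have : 2 ^ N.primeFactors.card ≤ 2 ^ X := by
      calc 2 ^ N.primeFactors.card ≤ ∏ p ∈ N.primeFactors, p :=
            Finset.pow_card_le_prod _ _ _ (fun p hp => (Nat.prime_of_mem_primeFactors hp).two_le)
        _ ≤ N := Nat.le_of_dvd hN (Nat.prod_primeFactors_dvd N)
        _ ≤ _ := hNX
    exact (Nat.pow_le_pow_iff_right (by norm_num)).1 this
  have hX0 : (0:ℝ) < X := by positivity
  have hbig : ∏ p ∈ N.primeFactors.filter (fun p => ¬ p ≤ X), ((p:ℝ) / (p-1)) ≤ Real.exp 1 := by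
    calc _ ≤ ∏ p ∈ N.primeFactors.filter (fun p => ¬ p ≤ X), Real.exp (1 / X) := by
          apply Finset.prod_le_prod
          · intro p hp
            have : (2:ℝ) ≤ p := by exact_mod_cast (Nat.prime_of_mem_primeFactors (mem_filter.1 hp).1).two_le
            apply div_nonneg <;> linarith
          · intro p hp
            have h1 := (mem_filter.1 hp).2
            have : (X:ℝ) + 1 ≤ p := by exact_mod_cast (by omega : X + 1 ≤ p)
            refine le_trans ?_ (Real.add_one_le_exp _)
            rw [div_le_iff₀ (by linarith)]
            have : 1 ≤ 1 / (X:ℝ) * (p - 1) := by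
              rw [one_div, inv_mul_eq_div, le_div_iff₀ hX0]; linarith
            linarith
      _ = Real.exp (((N.primeFactors.filter (fun p => ¬ p ≤ X)).card : ℝ) * (1/X)) := by
          rw [prod_const, ← Real.exp_nat_mul]
      _ ≤ _ := by
          apply Real.exp_le_exp.2
          rw [mul_one_div, div_le_one hX0]
          exact_mod_cast (card_filter_le _ _).trans hcard
  have hg1 : ∀ p : ℕ, p.Prime → (p:ℝ) / (p-1) ≤ 1 + (p:ℝ) / (p-1)^2 := by
    intro p hp
    have : (2:ℝ) ≤ p := by exact_mod_cast hp.two_le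
    have h : 1 + (p:ℝ) / (p-1)^2 - (p:ℝ) / (p-1) = 1 / (p-1)^2 := by
      have : (p:ℝ) - 1 ≠ 0 := by linarith
      field_simp; ring
    have : 0 ≤ 1 / ((p:ℝ)-1)^2 := by positivity
    linarith
  have hsmall : ∏ p ∈ N.primeFactors.filter (fun p => p ≤ X), ((p:ℝ) / (p-1)) ≤
      ∏ p ∈ (Icc 1 X).filter (fun p => Nat.Prime p ∧ p ∣ N), (1 + (p:ℝ) / (p-1)^2) := by
    have : N.primeFactors.filter (fun p => p ≤ X) = (Icc 1 X).filter (fun p => Nat.Prime p ∧ p ∣ N) := by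
      ext p
      simp only [mem_filter, Nat.mem_primeFactors, mem_Icc]
      constructor
      · rintro ⟨⟨h1, h2, h3⟩, h4⟩; exact ⟨⟨h1.one_le, h4⟩, h1, h2⟩
      · rintro ⟨⟨h1, h2⟩, h3, h4⟩; exact ⟨⟨h3, h4, by omega⟩, h2⟩
    rw [this]
    apply Finset.prod_le_prod
    · intro p hp
      have : (2:ℝ) ≤ p := by exact_mod_cast (mem_filter.1 hp).2.1.two_le
      apply div_nonneg <;> linarith
    · intro p hp
      exact hg1 p (mem_filter.1 hp).2.1
  have hsplit : (∏ p ∈ (Icc 1 X).filter (fun p => Nat.Prime p ∧ p ∣ N), (1 + (p:ℝ) / (p-1)^2)) *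
      (∏ p ∈ (Icc 1 X).filter (fun p => Nat.Prime p ∧ ¬ p ∣ N), (1 + (p:ℝ) / (p-1)^2)) =
      ∏ p ∈ (Icc 1 X).filter Nat.Prime, (1 + (p:ℝ) / (p-1)^2) := by
    rw [← filter_filter, ← filter_filter, prod_filter_mul_prod_filter_not]
  have hpos : ∀ s : Finset ℕ, 0 ≤ ∏ p ∈ s, (1 + (p:ℝ) / (p-1)^2) := fun s => prod_nonneg (fun _ _ => by positivity)
  rw [ds_tot N hN, ← prod_filter_mul_prod_filter_not _ (fun p => p ≤ X)]
  calc _ ≤ (∏ p ∈ (Icc 1 X).filter (fun p => Nat.Prime p ∧ p ∣ N), (1 + (p:ℝ) / (p-1)^2)) * Real.exp 1 *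
      (∏ p ∈ (Icc 1 X).filter (fun p => Nat.Prime p ∧ ¬ p ∣ N), (1 + (p:ℝ) / (p-1)^2)) := by
        have hb0 : 0 ≤ ∏ p ∈ N.primeFactors.filter (fun p => ¬ p ≤ X), ((p:ℝ) / (p-1)) := by
          apply prod_nonneg
          intro p hp
          have : (2:ℝ) ≤ p := by exact_mod_cast (Nat.prime_of_mem_primeFactors (mem_filter.1 hp).1).two_le
          apply div_nonneg <;> linarith
        apply mul_le_mul _ (dsS_le_prod N X) (dsS_nonneg _ _) (mul_nonneg (hpos _) (Real.exp_pos _).le)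
        exact mul_le_mul hsmall hbig hb0 (hpos _)
    _ = (∏ p ∈ (Icc 1 X).filter Nat.Prime, (1 + (p:ℝ) / (p-1)^2)) * Real.exp 1 := by
        rw [← hsplit]; ring
    _ ≤ C * Real.log X * Real.exp 1 := by
        gcongr
        exact hC X hX
    _ = _ := by ring

noncomputable def dsf (N c : ℕ) : ℝ := if Nat.Coprime c N then (c:ℝ) / Nat.totient c else 0

lemma dsf_nonneg (N c : ℕ) : 0 ≤ dsf N c := by
  rw [dsf]; split_ifs <;> positivity

lemma dsf_mul (N d q : ℕ) (hq : IsPrimePow q) : dsf N (d * q) ≤ 2 * dsf N d := by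
  have h0 := dsf_nonneg N d
  by_cases h : Nat.Coprime (d * q) N
  · have h1 := Nat.Coprime.coprime_mul_right h
    rw [dsf, dsf, if_pos h, if_pos h1]
    rcases Nat.eq_zero_or_pos d with rfl | hd
    · simp
    have hq2 : q ≤ 2 * Nat.totient q := by
      obtain ⟨p, k, hp, hk, rfl⟩ := hq
      have hp := hp.nat_prime
      rw [Nat.totient_prime_pow hp hk]
      obtain ⟨k, rfl⟩ : ∃ j, k = j + 1 := ⟨k-1, by omega⟩
      have : p ≤ 2 * (p-1) := by have := hp.two_le; omega
      calc p^(k+1) = p^k * p := pow_succ _ _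
        _ ≤ p^k * (2*(p-1)) := by gcongr
        _ = _ := by simp; ring
    have hs := Nat.totient_super_multiplicative d q
    have hqp : 0 < q := hq.pos
    have t1 := Nat.totient_pos.2 hd
    have t2 := Nat.totient_pos.2 (Nat.mul_pos hd hqp)
    rw [← mul_div_assoc, div_le_div_iff₀ (by positivity) (by positivity)]
    have : d * q * Nat.totient d ≤ 2 * d * Nat.totient (d * q) := by
      calc d * q * Nat.totient d ≤ d * (2 * Nat.totient q) * Nat.totient d := by gcongr
        _ = 2 * d * (Nat.totient d * Nat.totient q) := by ring
        _ ≤ _ := by gcongr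
    exact_mod_cast this
  · rw [dsf, if_neg h]; positivity

open ArithmeticFunction in
lemma ds_L5 : ∃ C : ℝ, 0 < C ∧ ∀ N X : ℕ, 2 ≤ X →
    (∑ c ∈ Icc 1 X, dsf N c) * Real.log X ≤ C * X * dsS N X := by
  refine ⟨2 * (Real.log 4 + 4) + 1, by positivity, fun N X hX => ?_⟩
  have hX0 : (0:ℝ) < X := by positivity
  have hS : dsS N X = ∑ c ∈ Icc 1 X, dsf N c / c := by
    rw [dsS, sum_filter]
    apply sum_congr rfl
    intro c hc
    have : (c:ℝ) ≠ 0 := by have := (mem_Icc.1 hc).1; positivity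
    rw [dsf]
    split_ifs
    · field_simp
    · simp
  have h1 : ∑ c ∈ Icc 1 X, dsf N c * (Real.log X - Real.log c) ≤ X * dsS N X := by
    rw [hS, mul_sum]
    apply sum_le_sum
    intro c hc
    have hc0 : (0:ℝ) < c := by have := (mem_Icc.1 hc).1; positivity
    have : Real.log X - Real.log c ≤ X / c := by
      rw [← Real.log_div hX0.ne' hc0.ne']
      exact (Real.log_le_sub_one_of_pos (by positivity)).trans (by linarith)
    calc _ ≤ dsf N c * (X / c) := mul_le_mul_of_nonneg_left this (dsf_nonneg _ _)
      _ = _ := by ring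
  let g : ArithmeticFunction ℝ := ⟨fun c => dsf N c, by simp [dsf]⟩
  have h2 : ∑ c ∈ Icc 1 X, dsf N c * Real.log c ≤ 2 * ∑ c ∈ Ioc 0 X, (g * Λ) c := by
    rw [mul_sum]
    apply sum_le_sum
    intro c hc
    rw [← vonMangoldt_sum, ← Nat.sum_divisorsAntidiagonal' (f := fun _ j => Λ j), ArithmeticFunction.mul_apply, mul_sum, mul_sum]
    apply sum_le_sum
    rintro ⟨d, q⟩ hdq
    rw [Nat.mem_divisorsAntidiagonal] at hdq
    simp only at hdq ⊢
    change dsf N c * Λ q ≤ 2 * (dsf N d * Λ q)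
    by_cases hq : IsPrimePow q
    · rw [← mul_assoc, ← hdq.1]
      exact mul_le_mul_of_nonneg_right (dsf_mul N d q hq) vonMangoldt_nonneg
    · rw [vonMangoldt_apply, if_neg hq]; simp
  have h3 : ∑ c ∈ Ioc 0 X, (g * Λ) c ≤ (Real.log 4 + 4) * X * dsS N X := by
    rw [sum_Ioc_mul_eq_sum_sum, hS, mul_sum]
    apply sum_le_sum
    intro d hd
    have hd1 : 0 < d := (mem_Ioc.1 hd).1
    change dsf N d * _ ≤ _
    have : ∑ m ∈ Ioc 0 (X / d), Λ m ≤ (Real.log 4 + 4) * (X / d) := by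
      have := Chebyshev.psi_le_const_mul_self (x := (X:ℝ) / d) (by positivity)
      rw [Chebyshev.psi, Nat.floor_div_eq_div] at this
      exact this
    calc _ ≤ dsf N d * ((Real.log 4 + 4) * (X / d)) := mul_le_mul_of_nonneg_left this (dsf_nonneg _ _)
      _ = _ := by ring
  have h4 : (∑ c ∈ Icc 1 X, dsf N c) * Real.log X = ∑ c ∈ Icc 1 X, dsf N c * (Real.log X - Real.log c) + ∑ c ∈ Icc 1 X, dsf N c * Real.log c := by
    rw [← sum_add_distrib, sum_mul]
    apply sum_congr rfl
    intros; ring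
  rw [h4]
  have e : (2 * (Real.log 4 + 4) + 1) * X * dsS N X = X * dsS N X + 2 * ((Real.log 4 + 4) * X * dsS N X) := by ring
  rw [e]
  linarith


lemma ds_geom (K : ℕ) (y : ℝ) (hy : 0 ≤ y) : ∑ k ∈ range K, (if (2:ℝ)^k ≤ y then (2:ℝ)^k else 0) ≤ 2 * y := by
  induction K with
  | zero => simpa using hy
  | succ K ih =>
    by_cases h : (2:ℝ)^K ≤ y
    · calc _ ≤ ∑ k ∈ range (K+1), (2:ℝ)^k := by
            apply sum_le_sum
            intro k _
            split_ifs
            · exact le_rfl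
            · positivity
        _ = 2^(K+1) - 1 := by rw [geom_sum_eq (by norm_num)]; norm_num
        _ ≤ 2 * y := by rw [pow_succ]; linarith
    · rw [sum_range_succ, if_neg h, add_zero]; exact ih

lemma ds_star (A : ℝ) (hA : 0 < A) : ∃ C : ℝ, 0 < C ∧ ∀ (N H K : ℕ) (D : ℝ), 1 ≤ N → N ≤ 2^H →
    2 ≤ H → 1 ≤ K → 4^K ≤ H → Real.log H ≤ A * K → 0 ≤ D →
    (N:ℝ) / Nat.totient N * ∑ k ∈ range K, (2:ℝ)^k * ∑ c ∈ Icc 1 ⌊D / 2^k⌋₊, dsf N c ≤ C * K * D := by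
  obtain ⟨C1, hC1, h1⟩ := ds_L4
  obtain ⟨C2, hC2, h2⟩ := ds_L5
  refine ⟨2 * C1 * A + C2 * (C1 * (1 + 2 * A)), by positivity, fun N H K D hN hNH hH hK hKH hlog hD => ?_⟩
  have hP : 0 ≤ (N:ℝ) / Nat.totient N := by positivity
  rcases le_total D (4^K) with hDK | hDK
  · have e1 : ∀ k ∈ range K, (2:ℝ)^k * ∑ c ∈ Icc 1 ⌊D / 2^k⌋₊, dsf N c =
        ∑ c ∈ Icc 1 ⌊D⌋₊, dsf N c * (if (2:ℝ)^k ≤ D / c then (2:ℝ)^k else 0) := by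
      intro k _
      have : Icc 1 ⌊D / 2^k⌋₊ = (Icc 1 ⌊D⌋₊).filter (fun c : ℕ => (2:ℝ)^k ≤ D / c) := by
        ext c
        simp only [mem_Icc, mem_filter]
        constructor
        · rintro ⟨hc1, hc2⟩
          have hc0 : (0:ℝ) < c := by positivity
          rw [Nat.le_floor_iff (by positivity), le_div_iff₀ (by positivity)] at hc2
          refine ⟨⟨hc1, ?_⟩, ?_⟩
          · rw [Nat.le_floor_iff hD]
            refine le_trans ?_ hc2
            exact le_mul_of_one_le_right hc0.le (one_le_pow₀ (by norm_num))
          · rw [le_div_iff₀ hc0]; linarith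
        · rintro ⟨⟨hc1, hc2⟩, hc3⟩
          have hc0 : (0:ℝ) < c := by positivity
          refine ⟨hc1, ?_⟩
          rw [Nat.le_floor_iff (by positivity), le_div_iff₀ (by positivity)]
          rw [le_div_iff₀ hc0] at hc3; linarith
      rw [this, sum_filter, mul_sum]
      apply sum_congr rfl
      intro c _
      split_ifs <;> ring
    rw [sum_congr rfl e1, sum_comm]
    have e2 : ∑ c ∈ Icc 1 ⌊D⌋₊, ∑ k ∈ range K, dsf N c * (if (2:ℝ)^k ≤ D / c then (2:ℝ)^k else 0) ≤ 2 * D * dsS N ⌊D⌋₊ := by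
      rw [dsS, sum_filter, mul_sum]
      apply sum_le_sum
      intro c hc
      rw [← mul_sum]
      have hc0 : (c:ℝ) ≠ 0 := by have := (mem_Icc.1 hc).1; positivity
      calc _ ≤ dsf N c * (2 * (D / c)) := mul_le_mul_of_nonneg_left (ds_geom _ _ (by positivity)) (dsf_nonneg _ _)
        _ = _ := by
          rw [dsf]; split_ifs
          · field_simp
          · simp
    have e3 : dsS N ⌊D⌋₊ ≤ dsS N H := by
      apply dsS_mono
      apply Nat.floor_le_of_le
      refine hDK.trans ?_
      exact_mod_cast hKH
    calc _ ≤ (N:ℝ) / Nat.totient N * (2 * D * dsS N H) := by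
          apply mul_le_mul_of_nonneg_left _ hP
          exact e2.trans (mul_le_mul_of_nonneg_left e3 (by positivity))
      _ = 2 * D * ((N:ℝ) / Nat.totient N * dsS N H) := by ring
      _ ≤ 2 * D * (C1 * (A * K)) := by
          apply mul_le_mul_of_nonneg_left _ (by positivity)
          exact (h1 N H hN hH hNH).trans (mul_le_mul_of_nonneg_left hlog hC1.le)
      _ = (2 * C1 * A) * K * D := by ring
      _ ≤ _ := by
          gcongr
          have : 0 ≤ C2 * (C1 * (1 + 2 * A)) := by positivity
          linarith
  · have key : ∀ k ∈ range K, (N:ℝ) / Nat.totient N * ((2:ℝ)^k * ∑ c ∈ Icc 1 ⌊D / 2^k⌋₊, dsf N c) ≤ C2 * (C1 * (1 + 2 * A)) * D := by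
      intro k hk
      rw [mem_range] at hk
      set X := ⌊D / 2^k⌋₊ with hX
      have hXK : 2^K ≤ X := by
        rw [hX, Nat.le_floor_iff (by positivity), le_div_iff₀ (by positivity)]
        refine le_trans ?_ hDK
        push_cast
        calc (2:ℝ)^K * 2^k ≤ 2^K * 2^K := by gcongr; norm_num
          _ = 4^K := by rw [← mul_pow]; norm_num
      have hX2 : 2 ≤ X := le_trans (by calc 2 = 2^1 := by norm_num
                                        _ ≤ 2^K := Nat.pow_le_pow_right (by norm_num) hK) hXK
      have hlX : 0 < Real.log X := Real.log_pos (by exact_mod_cast hX2)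
      have hlK : K ≤ 2 * Real.log X := by
        have : Real.log ((2:ℝ)^K) ≤ Real.log X := Real.log_le_log (by positivity) (by exact_mod_cast hXK)
        rw [Real.log_pow] at this
        have h3 := Real.log_two_gt_d9
        have h4 : (K:ℝ) * (1/2) ≤ K * Real.log 2 := by gcongr; linarith
        linarith
      have hA' : (N:ℝ) / Nat.totient N * dsS N X ≤ C1 * (1 + 2 * A) * Real.log X := by
        calc _ ≤ (N:ℝ) / Nat.totient N * dsS N (max X H) := mul_le_mul_of_nonneg_left (dsS_mono _ (le_max_left _ _)) hP
          _ ≤ C1 * Real.log (max X H : ℕ) := h1 _ _ hN (le_max_of_le_right hH) (hNH.trans (Nat.pow_le_pow_right (by norm_num) (le_max_right _ _)))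
          _ ≤ C1 * ((1 + 2 * A) * Real.log X) := by
              gcongr
              rcases le_total X H with h | h
              · rw [max_eq_right h]
                calc Real.log H ≤ A * K := hlog
                  _ ≤ A * (2 * Real.log X) := by gcongr
                  _ ≤ _ := by linarith
              · rw [max_eq_left h]
                have : 0 ≤ A * Real.log X := by positivity
                linarith
          _ = _ := by ring
      have h5 : (N:ℝ) / Nat.totient N * (∑ c ∈ Icc 1 X, dsf N c) ≤ C2 * (C1 * (1 + 2 * A)) * X := by
        apply le_of_mul_le_mul_right _ hlX
        calc _ = (N:ℝ) / Nat.totient N * ((∑ c ∈ Icc 1 X, dsf N c) * Real.log X) := by ring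
          _ ≤ (N:ℝ) / Nat.totient N * (C2 * X * dsS N X) := mul_le_mul_of_nonneg_left (h2 N X hX2) hP
          _ = C2 * X * ((N:ℝ) / Nat.totient N * dsS N X) := by ring
          _ ≤ C2 * X * (C1 * (1 + 2 * A) * Real.log X) := by gcongr
          _ = _ := by ring
      have hXD : (2:ℝ)^k * X ≤ D := by
        have := Nat.floor_le (a := D / 2^k) (by positivity)
        rw [← hX, le_div_iff₀ (by positivity)] at this
        linarith
      calc _ = (2:ℝ)^k * ((N:ℝ) / Nat.totient N * (∑ c ∈ Icc 1 X, dsf N c)) := by ring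
        _ ≤ (2:ℝ)^k * (C2 * (C1 * (1 + 2 * A)) * X) := by gcongr
        _ = C2 * (C1 * (1 + 2 * A)) * ((2:ℝ)^k * X) := by ring
        _ ≤ _ := by gcongr
    rw [mul_sum]
    refine (sum_le_sum key).trans ?_
    rw [sum_const, card_range, nsmul_eq_mul]
    calc (K:ℝ) * (C2 * (C1 * (1 + 2 * A)) * D) = (C2 * (C1 * (1 + 2 * A))) * K * D := by ring
      _ ≤ _ := by
          gcongr
          have : 0 ≤ 2 * C1 * A := by positivity
          linarith


lemma ds_crt2 (a b : ℕ) (hab : Nat.Coprime a b) (ha : 0 < a) (hb : 0 < b) (P Q : ℕ → Prop) [DecidablePred P] [DecidablePred Q]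
    (hP : ∀ t, P t ↔ P (t % a)) (hQ : ∀ t, Q t ↔ Q (t % b)) :
    ((range (a * b)).filter (fun t => P t ∧ Q t)).card =
      ((range a).filter P).card * ((range b).filter Q).card := by
  rw [← card_product]
  apply Finset.card_nbij' (fun t => (t % a, t % b)) (fun x => (Nat.chineseRemainder hab x.1 x.2 : ℕ))
  · intro t ht
    simp only [coe_filter, mem_range, Set.mem_setOf_eq] at ht
    simp only [coe_product, coe_filter, mem_range, Set.mem_prod, Set.mem_setOf_eq]
    exact ⟨⟨Nat.mod_lt _ ha, (hP t).1 ht.2.1⟩, ⟨Nat.mod_lt _ hb, (hQ t).1 ht.2.2⟩⟩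
  · rintro ⟨x, y⟩ hx
    simp only [coe_product, coe_filter, mem_range, Set.mem_prod, Set.mem_setOf_eq] at hx
    simp only [coe_filter, mem_range, Set.mem_setOf_eq]
    have h := (Nat.chineseRemainder hab x y).2
    refine ⟨Nat.chineseRemainder_lt_mul hab x y ha.ne' hb.ne', ?_, ?_⟩
    · rw [hP, h.1, ← hP]; exact hx.1.2
    · rw [hQ, h.2, ← hQ]; exact hx.2.2
  · intro t ht
    simp only [coe_filter, mem_range, Set.mem_setOf_eq] at ht
    have h := Nat.chineseRemainder_modEq_unique hab (a := t % a) (b := t % b) (z := t) (Nat.mod_modEq _ _).symm (Nat.mod_modEq _ _).symm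
    have h2 := Nat.chineseRemainder_lt_mul hab (t % a) (t % b) ha.ne' hb.ne'
    exact (Nat.ModEq.eq_of_lt_of_lt h ht.1 h2).symm
  · rintro ⟨x, y⟩ hx
    simp only [coe_product, coe_filter, mem_range, Set.mem_prod, Set.mem_setOf_eq] at hx
    have h := (Nat.chineseRemainder hab x y).2
    ext
    · simp only; rw [h.1, Nat.mod_eq_of_lt hx.1.1]
    · simp only; rw [h.2, Nat.mod_eq_of_lt hx.2.1]

lemma ds_crt (s : Finset ℕ) (hs : ∀ p ∈ s, p.Prime) (Q : ℕ → ℕ → Prop) [∀ p, DecidablePred (Q p)]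
    (hQ : ∀ p t, Q p t ↔ Q p (t % p)) :
    ((range (∏ p ∈ s, p)).filter (fun t => ∀ p ∈ s, Q p t)).card =
      ∏ p ∈ s, ((range p).filter (Q p)).card := by
  induction s using Finset.induction with
  | empty => simp
  | insert p s hp ih =>
    rw [prod_insert hp, prod_insert hp, ← ih (fun q hq => hs q (mem_insert_of_mem hq))]
    rw [← ds_crt2 p (∏ p ∈ s, p) _ _ _ (Q p) (fun t => ∀ q ∈ s, Q q t) (hQ p)]
    · congr 1
      ext t
      simp
    · intro t
      apply forall₂_congr
      intro q hq
      rw [hQ q t, hQ q (t % ∏ p ∈ s, p), Nat.mod_mod_of_dvd _ (dvd_prod_of_mem (fun p => p) hq)]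
    · apply Nat.Coprime.prod_right
      intro q hq
      rw [Nat.coprime_primes (hs p (mem_insert_self _ _)) (hs q (mem_insert_of_mem hq))]
      rintro rfl; exact hp hq
    · exact (hs p (mem_insert_self _ _)).pos
    · exact prod_pos (fun q hq => (hs q (mem_insert_of_mem hq)).pos)

lemma ds_periodic (P : ℕ → Prop) [DecidablePred P] (a h : ℕ) (hP : ∀ t, P t ↔ P (t % a)) :
    ((range (a * h)).filter P).card = h * ((range a).filter P).card := by
  have hper : Function.Periodic P a := by
    intro t
    rw [eq_iff_iff, hP, hP t]; simp
  induction h with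
  | zero => simp
  | succ h ih =>
    have : range (a * (h+1)) = range (a*h) ∪ Ico (a*h) (a*h+a) := by
      ext t; simp; rw [mul_add]; omega
    rw [this, filter_union, card_union_of_disjoint, ih, Nat.filter_Ico_card_eq_of_periodic _ _ _ hper, Nat.count_eq_card_filter_range]
    · ring
    · apply disjoint_filter_filter
      rw [disjoint_left]
      intro t; simp; omega

lemma ds_count (g : ℕ) (hg : 0 < g) (Q : ℕ → ℕ → Prop) [∀ p, DecidablePred (Q p)]
    (hQ : ∀ p t, Q p t ↔ Q p (t % p)) :
    (((range g).filter (fun t => ∀ p ∈ g.primeFactors, Q p t)).card : ℝ) =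
      g * ∏ p ∈ g.primeFactors, (((range p).filter (Q p)).card / (p:ℝ)) := by
  obtain ⟨h, hh⟩ := Nat.prod_primeFactors_dvd g
  have e := ds_crt g.primeFactors (fun p hp => Nat.prime_of_mem_primeFactors hp) Q hQ
  have e2 := ds_periodic (fun t => ∀ p ∈ g.primeFactors, Q p t) (∏ p ∈ g.primeFactors, p) h (by
      intro t
      apply forall₂_congr
      intro q hq
      rw [hQ q t, hQ q (t % ∏ p ∈ g.primeFactors, p), Nat.mod_mod_of_dvd _ (dvd_prod_of_mem (fun p => p) hq)])
  rw [← hh, e] at e2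
  rw [e2, prod_div_distrib]
  push_cast
  have hg' : (g:ℝ) = (∏ p ∈ g.primeFactors, (p:ℝ)) * h := by
    conv_lhs => rw [hh]
    push_cast; rfl
  have : (∏ p ∈ g.primeFactors, (p:ℝ)) ≠ 0 := by
    rw [prod_ne_zero_iff]; intro p hp
    have := (Nat.prime_of_mem_primeFactors hp).pos; positivity
  rw [mul_div_assoc']
  rw [eq_div_iff this]
  nth_rw 1 [hg']
  ring

lemma ds_root (p : ℕ) (hp : p.Prime) (a m : ℤ) (hm : ¬ (p:ℤ) ∣ m) : ∃ t ∈ range p, (p:ℤ) ∣ a + m * t := by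
  haveI := Fact.mk hp
  have hm' : (m : ZMod p) ≠ 0 := by rwa [Ne, ZMod.intCast_zmod_eq_zero_iff_dvd]
  refine ⟨(-(a : ZMod p) / m).val, mem_range.2 (ZMod.val_lt _), ?_⟩
  rw [← ZMod.intCast_zmod_eq_zero_iff_dvd]
  push_cast
  rw [ZMod.natCast_zmod_val]
  field_simp
  ring

lemma ds_local (p : ℕ) (hp : p.Prime) (a b m n c : ℤ) (hmn : IsCoprime m n)
    (hc : (p:ℤ) ∣ a * n - b * m - c) :
    ((((range p).filter (fun t : ℕ => ¬ (p:ℤ) ∣ a + m * t ∧ ¬ (p:ℤ) ∣ b + n * t)).card : ℝ)) / p ≤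
      ((p:ℝ)/(p-1))⁻¹ ^ 2 * (if (p:ℤ) ∣ m then (p:ℝ)/(p-1) else 1) * (if (p:ℤ) ∣ n then (p:ℝ)/(p-1) else 1) *
        (if (p:ℤ) ∣ c then (p:ℝ)/(p-1) else 1) := by
  have hp2 : (2:ℝ) ≤ p := by exact_mod_cast hp.two_le
  have hp1 : (p:ℝ) - 1 ≠ 0 := by linarith
  have hpn := hp.two_le
  set S := (range p).filter (fun t : ℕ => ¬ (p:ℤ) ∣ a + m * t ∧ ¬ (p:ℤ) ∣ b + n * t)
  have hv : 1 ≤ (p:ℝ)/(p-1) := by rw [le_div_iff₀ (by linarith)]; linarith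
  set v := (p:ℝ)/(p-1) with hvdef
  have hv0 : 0 < v := by linarith
  have h1m : (1:ℝ) ≤ if (p:ℤ) ∣ m then v else 1 := by split_ifs <;> linarith
  have h1n : (1:ℝ) ≤ if (p:ℤ) ∣ n then v else 1 := by split_ifs <;> linarith
  have h1c : (1:ℝ) ≤ if (p:ℤ) ∣ c then v else 1 := by split_ifs <;> linarith
  have hm1 : ¬ (p:ℤ) ∣ m → ∃ t ∈ range p, S ⊆ (range p).erase t ∧ (p:ℤ) ∣ a + m * t := by
    intro h
    obtain ⟨t, ht, h2⟩ := ds_root p hp a m h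
    refine ⟨t, ht, ?_, h2⟩
    intro x hx
    rw [mem_filter] at hx
    rw [mem_erase]
    refine ⟨?_, hx.1⟩
    rintro rfl; exact hx.2.1 h2
  have hn1 : ¬ (p:ℤ) ∣ n → ∃ t ∈ range p, S ⊆ (range p).erase t ∧ (p:ℤ) ∣ b + n * t := by
    intro h
    obtain ⟨t, ht, h2⟩ := ds_root p hp b n h
    refine ⟨t, ht, ?_, h2⟩
    intro x hx
    rw [mem_filter] at hx
    rw [mem_erase]
    refine ⟨?_, hx.1⟩
    rintro rfl; exact hx.2.2 h2
  have hor : ¬ (p:ℤ) ∣ m ∨ ¬ (p:ℤ) ∣ n := by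
    by_contra! h
    have := hmn.isUnit_of_dvd' h.1 h.2
    rw [Int.isUnit_iff] at this
    omega
  have hS1 : S.card ≤ p - 1 := by
    rcases hor with h | h
    · obtain ⟨t, ht, h2, _⟩ := hm1 h
      have := card_le_card h2
      rwa [card_erase_of_mem ht, card_range] at this
    · obtain ⟨t, ht, h2, _⟩ := hn1 h
      have := card_le_card h2
      rwa [card_erase_of_mem ht, card_range] at this
  have hS1' : (S.card : ℝ) / p ≤ v⁻¹ := by
    rw [hvdef, inv_div]
    gcongr
    have : (S.card : ℝ) ≤ ((p - 1 : ℕ) : ℝ) := by exact_mod_cast hS1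
    rwa [Nat.cast_sub (by omega), Nat.cast_one] at this
  have hve : v⁻¹ ^ 2 * v = v⁻¹ := by field_simp
  by_cases hm : (p:ℤ) ∣ m
  · rw [if_pos hm, hve]
    refine hS1'.trans ?_
    have : 0 < v⁻¹ := by positivity
    calc v⁻¹ = v⁻¹ * 1 * 1 := by ring
      _ ≤ _ := by gcongr
  by_cases hn : (p:ℤ) ∣ n
  · rw [if_neg hm, if_pos hn, mul_one, hve]
    refine hS1'.trans ?_
    have : 0 < v⁻¹ := by positivity
    calc v⁻¹ = v⁻¹ * 1 := by ring
      _ ≤ _ := by gcongr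
  by_cases hcc : (p:ℤ) ∣ c
  · rw [if_neg hm, if_neg hn, if_pos hcc, mul_one, mul_one, hve]
    exact hS1'
  rw [if_neg hm, if_neg hn, if_neg hcc, mul_one, mul_one, mul_one]
  obtain ⟨t1, ht1, hs1, hd1⟩ := hm1 hm
  obtain ⟨t2, ht2, hs2, hd2⟩ := hn1 hn
  have hne : t2 ≠ t1 := by
    rintro rfl
    apply hcc
    have h := (hd1.mul_right n).sub (hd2.mul_right m)
    have h3 := h.sub hc
    have e : (a + m * t2) * n - (b + n * t2) * m - (a * n - b * m - c) = c := by ring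
    rwa [e] at h3
  have hS2 : S.card ≤ p - 1 - 1 := by
    have : S ⊆ ((range p).erase t1).erase t2 := by
      intro x hx
      have h1 := hs1 hx
      have h2 := hs2 hx
      simp only [mem_erase] at h1 h2 ⊢
      exact ⟨h2.1, h1⟩
    have := card_le_card this
    rwa [card_erase_of_mem (mem_erase.2 ⟨hne, ht2⟩), card_erase_of_mem ht1, card_range] at this
  have h4 : (S.card : ℝ) ≤ p - 2 := by
    have : S.card + 2 ≤ p := by omega
    have : (S.card : ℝ) + 2 ≤ p := by exact_mod_cast this
    linarith
  rw [hvdef, inv_div, div_pow, div_le_div_iff₀ (by linarith) (by positivity)]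
  calc (S.card : ℝ) * p^2 ≤ (p-2) * p^2 := by gcongr
    _ ≤ _ := by nlinarith

noncomputable def dsR (n : ℕ) : Finset ℕ := (range n).filter (fun a => Nat.Coprime a n)

lemma dsR_card (n : ℕ) : (dsR n).card = Nat.totient n := by
  rw [dsR, Nat.totient]
  congr 1
  ext a
  simp [Nat.coprime_comm]

noncomputable def dsSol (g m n : ℕ) (c : ℤ) : Finset (ℕ × ℕ) :=
  ((dsR (g*m)) ×ˢ (dsR (g*n))).filter (fun x => ((g*m*n:ℕ):ℤ) ∣ (x.1:ℤ) * n - x.2 * m - c)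

lemma ds_sol_coprime (g m n : ℕ) (hmn : Nat.Coprime m n) (c : ℤ) (x : ℕ × ℕ) (hx : x ∈ dsSol g m n c) :
    Nat.Coprime c.natAbs (m * n) := by
  simp only [dsSol, dsR, mem_filter, mem_product, mem_range] at hx
  obtain ⟨⟨⟨_, h1⟩, _, h2⟩, h3⟩ := hx
  apply Nat.coprime_of_dvd
  intro p hp hpc hpmn
  have hpc' : (p:ℤ) ∣ c := Int.natCast_dvd.2 hpc
  rcases (hp.dvd_mul).1 hpmn with h | h
  · have hp1 : (p:ℤ) ∣ x.1 * n - x.2 * m - c := by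
      refine dvd_trans ?_ h3
      exact_mod_cast (h.mul_left g).mul_right n
    have : (p:ℤ) ∣ x.1 * n := by
      have hm : (p:ℤ) ∣ x.2 * m := Dvd.dvd.mul_left (by exact_mod_cast h) _
      have := (hp1.add hm).add hpc'
      convert! this using 1; ring
    have : p ∣ x.1 * n := by exact_mod_cast this
    rcases (hp.dvd_mul).1 this with h' | h'
    · exact Nat.not_coprime_of_dvd_of_dvd hp.one_lt h' (h.mul_left g) h1
    · exact Nat.not_coprime_of_dvd_of_dvd hp.one_lt h h' hmn
  · have hp1 : (p:ℤ) ∣ x.1 * n - x.2 * m - c := by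
      refine dvd_trans ?_ h3
      exact_mod_cast (h.mul_left (g*m))
    have : (p:ℤ) ∣ x.2 * m := by
      have hm : (p:ℤ) ∣ x.1 * n := Dvd.dvd.mul_left (by exact_mod_cast h) _
      have := (hm.sub hp1).sub hpc'
      convert! this using 1; ring
    have : p ∣ x.2 * m := by exact_mod_cast this
    rcases (hp.dvd_mul).1 this with h' | h'
    · exact Nat.not_coprime_of_dvd_of_dvd hp.one_lt h' (h.mul_left g) h2
    · exact Nat.not_coprime_of_dvd_of_dvd hp.one_lt h' h hmn

lemma ds_prodsplit (g m : ℕ) (hg : 0 < g) (hm : 0 < m) :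
    ((g*m:ℕ):ℝ) / Nat.totient (g*m) * ∏ p ∈ g.primeFactors, (if (p:ℤ) ∣ (m:ℤ) then (p:ℝ)/(p-1) else 1) =
      (g:ℝ) / Nat.totient g * ((m:ℝ) / Nat.totient m) := by
  rw [ds_tot _ (Nat.mul_pos hg hm), ds_tot _ hg, ds_tot _ hm, Nat.primeFactors_mul hg.ne' hm.ne',
    ← prod_filter, ← prod_union_inter (s₁ := g.primeFactors) (s₂ := m.primeFactors) (f := fun p : ℕ => (p:ℝ)/(p-1))]
  congr 1
  apply prod_congr _ (fun _ _ => rfl)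
  ext p
  simp only [mem_filter, mem_inter, Nat.mem_primeFactors]
  constructor
  · rintro ⟨h1, h2⟩; exact ⟨h1, h1.1, by exact_mod_cast h2, hm.ne'⟩
  · rintro ⟨h1, h2⟩; exact ⟨h1, by exact_mod_cast h2.2.1⟩

lemma ds_sol_card_t (g m n : ℕ) (hg : 0 < g) (hm : 0 < m) (hn : 0 < n) (hmn : Nat.Coprime m n) (c : ℤ)
    (x0 : ℕ × ℕ) (hx0 : x0 ∈ dsSol g m n c) :
    (dsSol g m n c).card ≤ ((range g).filter (fun t : ℕ => ∀ p ∈ g.primeFactors,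
      (¬ (p:ℤ) ∣ (x0.1:ℤ) + m * t ∧ ¬ (p:ℤ) ∣ (x0.2:ℤ) + n * t))).card := by
  have hgz : (0:ℤ) < g := by exact_mod_cast hg
  have hmz : (0:ℤ) < m := by exact_mod_cast hm
  have hnz : (0:ℤ) < n := by exact_mod_cast hn
  have key : ∀ x ∈ dsSol g m n c, ∃ t : ℕ, t < g ∧ ((g*m:ℕ):ℤ) ∣ (x.1:ℤ) - (x0.1 + m * t) ∧
      ((g*n:ℕ):ℤ) ∣ (x.2:ℤ) - (x0.2 + n * t) := by
    intro x hx
    simp only [dsSol, mem_filter] at hx hx0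
    have h := hx.2.sub hx0.2
    have e : (x.1:ℤ) * n - x.2 * m - c - (x0.1 * n - x0.2 * m - c) = (x.1 - x0.1) * n - (x.2 - x0.2) * m := by ring
    rw [e] at h
    have h1 : (m:ℤ) ∣ (x.1 - x0.1) * n := by
      have h2 : (m:ℤ) ∣ ((x.1:ℤ) - x0.1) * n - (x.2 - x0.2) * m := by
        refine dvd_trans ?_ h
        push_cast
        exact ⟨g * n, by ring⟩
      have := h2.add (Dvd.intro_left ((x.2:ℤ) - x0.2) rfl)
      simpa using this
    have h2 : (m:ℤ) ∣ (x.1:ℤ) - x0.1 := by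
      apply IsCoprime.dvd_of_dvd_mul_right _ h1
      exact Nat.isCoprime_iff_coprime.2 hmn
    obtain ⟨s, hs⟩ := h2
    have h3 : ((g*n:ℕ):ℤ) ∣ s * n - (x.2 - x0.2) := by
      rw [hs] at h
      have : ((g*m*n:ℕ):ℤ) = m * (g*n:ℕ) := by push_cast; ring
      rw [this] at h
      have e2 : (m:ℤ) * s * n - (x.2 - x0.2) * m = m * (s * n - (x.2 - x0.2)) := by ring
      rw [e2] at h
      exact (mul_dvd_mul_iff_left hmz.ne').1 h
    have hsg := Int.emod_add_mul_ediv s g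
    have hs0 := Int.emod_nonneg s hgz.ne'
    have hs1 := Int.emod_lt_of_pos s hgz
    obtain ⟨t, ht⟩ := Int.eq_ofNat_of_zero_le hs0
    refine ⟨t, by omega, ?_, ?_⟩
    · refine ⟨s / g, ?_⟩
      have : (x.1:ℤ) - (x0.1 + m * t) = m * s - m * t := by rw [← hs]; ring
      rw [this, ← ht]
      nth_rw 1 [← hsg]
      push_cast; ring
    · have h4 : ((g*n:ℕ):ℤ) ∣ n * s - n * t := by
        refine ⟨s / g, ?_⟩
        rw [← ht]
        nth_rw 1 [← hsg]
        push_cast; ring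
      have := h4.sub h3
      convert! this using 1; ring
  choose! T hT using key
  apply card_le_card_of_injOn T
  · intro x hx
    obtain ⟨h1, h2, h3⟩ := hT x hx
    simp only [dsSol, dsR, mem_coe, mem_filter, mem_product, mem_range] at hx
    simp only [coe_filter, mem_range, Set.mem_setOf_eq]
    refine ⟨h1, fun p hp => ⟨fun hd => ?_, fun hd => ?_⟩⟩
    · have hpp := Nat.prime_of_mem_primeFactors hp
      have hpg := (Nat.dvd_of_mem_primeFactors hp).mul_right m
      have : (p:ℤ) ∣ (x.1:ℤ) - (x0.1 + m * T x) := dvd_trans (by exact_mod_cast hpg) h2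
      have := this.add hd
      rw [sub_add_cancel] at this
      exact Nat.not_coprime_of_dvd_of_dvd hpp.one_lt (by exact_mod_cast this) hpg hx.1.1.2
    · have hpp := Nat.prime_of_mem_primeFactors hp
      have hpg := (Nat.dvd_of_mem_primeFactors hp).mul_right n
      have : (p:ℤ) ∣ (x.2:ℤ) - (x0.2 + n * T x) := dvd_trans (by exact_mod_cast hpg) h3
      have := this.add hd
      rw [sub_add_cancel] at this
      exact Nat.not_coprime_of_dvd_of_dvd hpp.one_lt (by exact_mod_cast this) hpg hx.1.2.2
  · intro x hx y hy hxy
    obtain ⟨_, h2, h3⟩ := hT x hx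
    obtain ⟨_, h2', h3'⟩ := hT y hy
    rw [← hxy] at h2' h3'
    simp only [dsSol, dsR, mem_coe, mem_filter, mem_product, mem_range] at hx hy
    have d1 := h2'.sub h2
    have d2 := h3'.sub h3
    rw [sub_sub_sub_cancel_right] at d1 d2
    have f : ∀ (a b k : ℕ), a < k → b < k → ((k:ℕ):ℤ) ∣ (b:ℤ) - a → a = b := by
      intro a b k ha hb hd
      have := (Nat.modEq_iff_dvd (n := k)).2 hd
      exact Nat.ModEq.eq_of_lt_of_lt this ha hb
    exact Prod.ext (f _ _ _ hx.1.1.1 hy.1.1.1 d1) (f _ _ _ hx.1.2.1 hy.1.2.1 d2)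

lemma ds_sol_card (g m n : ℕ) (hg : 0 < g) (hm : 0 < m) (hn : 0 < n) (hmn : Nat.Coprime m n) (c : ℤ) (hc : c ≠ 0) :
    ((dsSol g m n c).card : ℝ) ≤ g * ((Nat.totient (g*m):ℝ) / (g*m:ℕ)) * ((Nat.totient (g*n):ℝ) / (g*n:ℕ)) *
      (((m*n:ℕ):ℝ) / Nat.totient (m*n)) * dsf (m*n) c.natAbs := by
  rcases (dsSol g m n c).eq_empty_or_nonempty with h | ⟨x0, hx0⟩
  · rw [h]
    have := dsf_nonneg (m*n) c.natAbs
    simp only [card_empty, Nat.cast_zero]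
    positivity
  have hcop := ds_sol_coprime g m n hmn c x0 hx0
  have h1 := ds_sol_card_t g m n hg hm hn hmn c x0 hx0
  have h1' : ((dsSol g m n c).card : ℝ) ≤ _ := Nat.cast_le.2 h1
  rw [ds_count g hg (fun p t => ¬ (p:ℤ) ∣ (x0.1:ℤ) + m * (t:ℕ) ∧ ¬ (p:ℤ) ∣ (x0.2:ℤ) + n * (t:ℕ))] at h1'
  swap
  · intro p t
    have hpt : (p:ℤ) ∣ (t:ℤ) - ((t % p : ℕ):ℤ) := (Nat.modEq_iff_dvd).1 (Nat.mod_modEq t p)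
    have h : ∀ a m : ℤ, (p:ℤ) ∣ a + m * t ↔ (p:ℤ) ∣ a + m * ((t % p : ℕ):ℤ) := by
      intro a m
      have := hpt.mul_left m
      constructor
      · intro h; convert! h.sub this using 1; ring
      · intro h; convert! h.add this using 1; ring
    simp only [h]
  refine h1'.trans ?_
  have hmnz : IsCoprime (m:ℤ) (n:ℤ) := Nat.isCoprime_iff_coprime.2 hmn
  have h2 : ∏ p ∈ g.primeFactors, ((((range p).filter (fun t : ℕ => ¬ (p:ℤ) ∣ (x0.1:ℤ) + m * t ∧ ¬ (p:ℤ) ∣ (x0.2:ℤ) + n * t)).card : ℝ) / p) ≤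
      ∏ p ∈ g.primeFactors, (((p:ℝ)/(p-1))⁻¹ ^ 2 * (if (p:ℤ) ∣ (m:ℤ) then (p:ℝ)/(p-1) else 1) * (if (p:ℤ) ∣ (n:ℤ) then (p:ℝ)/(p-1) else 1) *
        (if (p:ℤ) ∣ c then (p:ℝ)/(p-1) else 1)) := by
    apply Finset.prod_le_prod
    · intros; positivity
    · intro p hp
      apply ds_local p (Nat.prime_of_mem_primeFactors hp) _ _ _ _ _ hmnz
      simp only [dsSol, mem_filter] at hx0
      refine dvd_trans ?_ hx0.2
      exact_mod_cast ((Nat.dvd_of_mem_primeFactors hp).mul_right m).mul_right n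
  have hc0 : 1 ≤ c.natAbs := Int.natAbs_pos.2 hc
  have h3 : ∏ p ∈ g.primeFactors, (if (p:ℤ) ∣ c then (p:ℝ)/(p-1) else 1) ≤ (c.natAbs:ℝ) / Nat.totient c.natAbs := by
    rw [ds_tot _ hc0, ← prod_filter]
    have hv : ∀ p : ℕ, p.Prime → 1 ≤ (p:ℝ)/(p-1) := by
      intro p hp
      have hp2 : (2:ℝ) ≤ p := by exact_mod_cast hp.two_le
      rw [le_div_iff₀ (by linarith)]; linarith
    apply Finset.prod_le_prod_of_subset_of_one_le
    · intro p hp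
      rw [mem_filter] at hp
      have := Nat.prime_of_mem_primeFactors hp.1
      exact Nat.mem_primeFactors.2 ⟨this, Int.natCast_dvd.1 hp.2, by omega⟩
    · intro p hp
      rw [mem_filter] at hp
      have := hv p (Nat.prime_of_mem_primeFactors hp.1)
      linarith
    · intro p hp _
      exact hv p (Nat.prime_of_mem_primeFactors hp)
  have hA := ds_prodsplit g m hg hm
  have hB := ds_prodsplit g n hg hn
  have hf : dsf (m*n) c.natAbs = (c.natAbs:ℝ) / Nat.totient c.natAbs := by
    rw [dsf, if_pos hcop]
  have hG : ∏ p ∈ g.primeFactors, ((p:ℝ)/(p-1))⁻¹ ^ 2 = ((g:ℝ)/Nat.totient g)⁻¹ ^ 2 := by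
    rw [prod_pow, prod_inv_distrib, ← ds_tot g hg]
  rw [prod_mul_distrib, prod_mul_distrib, prod_mul_distrib, hG] at h2
  set A := ∏ p ∈ g.primeFactors, (if (p:ℤ) ∣ (m:ℤ) then (p:ℝ)/(p-1) else 1)
  set B := ∏ p ∈ g.primeFactors, (if (p:ℤ) ∣ (n:ℤ) then (p:ℝ)/(p-1) else 1)
  set Cc := ∏ p ∈ g.primeFactors, (if (p:ℤ) ∣ c then (p:ℝ)/(p-1) else 1)
  rw [hf, Nat.totient_mul hmn]
  have p1 : (0:ℝ) < Nat.totient g := by exact_mod_cast Nat.totient_pos.2 hg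
  have p2 : (0:ℝ) < Nat.totient m := by exact_mod_cast Nat.totient_pos.2 hm
  have p3 : (0:ℝ) < Nat.totient n := by exact_mod_cast Nat.totient_pos.2 hn
  have p4 : (0:ℝ) < Nat.totient (g*m) := by exact_mod_cast Nat.totient_pos.2 (Nat.mul_pos hg hm)
  have p5 : (0:ℝ) < Nat.totient (g*n) := by exact_mod_cast Nat.totient_pos.2 (Nat.mul_pos hg hn)
  have q1 : (0:ℝ) < g := by exact_mod_cast hg
  have q2 : (0:ℝ) < m := by exact_mod_cast hm
  have q3 : (0:ℝ) < n := by exact_mod_cast hn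
  have q4 : (0:ℝ) < (g*m:ℕ) := by exact_mod_cast Nat.mul_pos hg hm
  have q5 : (0:ℝ) < (g*n:ℕ) := by exact_mod_cast Nat.mul_pos hg hn
  have hA' : A = (Nat.totient (g*m):ℝ) / (g*m:ℕ) * ((g:ℝ) / Nat.totient g * ((m:ℝ) / Nat.totient m)) := by
    rw [← hA]; field_simp
  have hB' : B = (Nat.totient (g*n):ℝ) / (g*n:ℕ) * ((g:ℝ) / Nat.totient g * ((n:ℝ) / Nat.totient n)) := by
    rw [← hB]; field_simp
  calc _ ≤ (g:ℝ) * (((g:ℝ)/Nat.totient g)⁻¹ ^ 2 * A * B * Cc) := by gcongr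
    _ ≤ (g:ℝ) * (((g:ℝ)/Nat.totient g)⁻¹ ^ 2 * A * B * ((c.natAbs:ℝ) / Nat.totient c.natAbs)) := by
        have : 0 ≤ A := by rw [hA']; positivity
        have : 0 ≤ B := by rw [hB']; positivity
        gcongr
    _ = _ := by
        rw [hA', hB']
        generalize (c.natAbs:ℝ) / Nat.totient c.natAbs = z
        generalize (Nat.totient (g*m):ℝ) / (g*m:ℕ) = z1
        generalize (Nat.totient (g*n):ℝ) / (g*n:ℕ) = z2
        push_cast
        field_simp


noncomputable def dsCnt (m n : ℕ) (δ : ℝ) : ℕ :=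
  (((dsR m) ×ˢ (dsR n)).filter (fun x => ‖(((x.1:ℝ)/m : ℝ) : UnitAddCircle) - (((x.2:ℝ)/n : ℝ) : UnitAddCircle)‖ < δ)).card

lemma ds_sol_zero (g m n : ℕ) (hmn : Nat.Coprime m n) :
    ((dsSol g m n 0).card) ≤ if g * m = g * n then Nat.totient (g*n) else 0 := by
  rcases (dsSol g m n 0).eq_empty_or_nonempty with h | ⟨x0, hx0⟩
  · rw [h]; simp
  have hcop := ds_sol_coprime g m n hmn 0 x0 hx0
  rw [Int.natAbs_zero, Nat.coprime_zero_left] at hcop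
  have hm1 : m = 1 := Nat.eq_one_of_mul_eq_one_right hcop
  have hn1 : n = 1 := Nat.eq_one_of_mul_eq_one_left hcop
  subst hm1 hn1
  rw [if_pos rfl, ← dsR_card]
  apply card_le_card_of_injOn Prod.fst
  · intro x hx
    simp only [dsSol, mem_coe, mem_filter, mem_product] at hx
    exact hx.1.1
  · have key : ∀ x ∈ dsSol g 1 1 0, x.1 = x.2 := by
      intro x hx
      simp only [dsSol, dsR, mem_filter, mem_product, mem_range] at hx
      obtain ⟨⟨⟨h1, _⟩, h2, _⟩, h3⟩ := hx
      have : ((g*1:ℕ):ℤ) ∣ (x.1:ℤ) - x.2 := by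
        have h4 : ((g*1:ℕ):ℤ) ∣ (x.1:ℤ) * ((1:ℕ):ℤ) - x.2 * ((1:ℕ):ℤ) - 0 := by
          rw [mul_one] at h3; exact h3
        simpa using h4
      exact (Nat.ModEq.eq_of_lt_of_lt ((Nat.modEq_iff_dvd).2 this) h2 h1).symm
    intro x hx y hy hxy
    have e1 := key x hx
    have e2 := key y hy
    exact Prod.ext hxy (by rw [← e1, ← e2]; exact hxy)

lemma ds_cnt_le (g m n : ℕ) (hg : 0 < g) (hm : 0 < m) (hn : 0 < n) (δ : ℝ) :
    dsCnt (g*m) (g*n) δ ≤ ∑ c ∈ Icc (-(⌊δ * (g*m*n:ℕ)⌋₊:ℤ)) (⌊δ * (g*m*n:ℕ)⌋₊:ℤ), (dsSol g m n c).card := by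
  classical
  refine le_trans (card_le_card ?_) card_biUnion_le
  intro x hx
  simp only [mem_filter, mem_product] at hx
  obtain ⟨⟨h1, h2⟩, h3⟩ := hx
  rw [← QuotientAddGroup.mk_sub] at h3
  have hL : (0:ℝ) < (g*m*n:ℕ) := by exact_mod_cast Nat.mul_pos (Nat.mul_pos hg hm) hn
  have q1 : (0:ℝ) < g := by exact_mod_cast hg
  have q2 : (0:ℝ) < m := by exact_mod_cast hm
  have q3 : (0:ℝ) < n := by exact_mod_cast hn
  change ‖((((x.1:ℝ)/(g*m:ℕ) - (x.2:ℝ)/(g*n:ℕ)) : ℝ) : UnitAddCircle)‖ < δ at h3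
  rw [UnitAddCircle.norm_eq] at h3
  set y := (x.1:ℝ)/(g*m:ℕ) - (x.2:ℝ)/(g*n:ℕ) with hy
  have e : ((((x.1:ℤ) * n - x.2 * m - (g*m*n:ℕ) * round y : ℤ)) : ℝ) = (g*m*n:ℕ) * (y - round y) := by
    have : (g*m*n:ℕ) * y = x.1 * n - x.2 * m := by
      rw [hy]; push_cast; field_simp
    rw [mul_sub, this]; push_cast; ring
  rw [mem_biUnion]
  refine ⟨(x.1:ℤ) * n - x.2 * m - (g*m*n:ℕ) * round y, ?_, ?_⟩
  · rw [mem_Icc, ← abs_le, Int.abs_eq_natAbs, Nat.cast_le]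
    apply Nat.le_floor
    rw [Nat.cast_natAbs, Int.cast_abs, e, abs_mul, abs_of_pos hL, mul_comm]
    gcongr
  · simp only [dsSol, mem_filter, mem_product]
    refine ⟨⟨h1, h2⟩, ⟨round y, by ring⟩⟩

lemma ds_sumsym (f : ℤ → ℝ) (M : ℕ) :
    ∑ c ∈ Icc (-(M:ℤ)) M, f c = f 0 + ∑ c ∈ Icc 1 M, (f c + f (-(c:ℤ))) := by
  induction M with
  | zero => simp
  | succ M ih =>
    have : Icc (-((M+1:ℕ):ℤ)) ((M+1:ℕ):ℤ) = insert (-((M+1:ℕ):ℤ)) (insert ((M+1:ℕ):ℤ) (Icc (-(M:ℤ)) M)) := by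
      ext t; simp only [mem_Icc, mem_insert]; omega
    rw [this, sum_insert, sum_insert, ih, ← Finset.insert_Icc_right_eq_Icc_add_one (by omega), sum_insert]
    · push_cast; ring
    · simp
    · simp
    · simp only [mem_Icc, mem_insert]; omega

lemma ds_cnt_real (g m n : ℕ) (hg : 0 < g) (hm : 0 < m) (hn : 0 < n) (hmn : Nat.Coprime m n) (δ : ℝ) :
    (dsCnt (g*m) (g*n) δ : ℝ) ≤ (if g * m = g * n then (Nat.totient (g*n):ℝ) else 0) +
      2 * (g * ((Nat.totient (g*m):ℝ) / (g*m:ℕ)) * ((Nat.totient (g*n):ℝ) / (g*n:ℕ)) *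
      (((m*n:ℕ):ℝ) / Nat.totient (m*n))) * ∑ c ∈ Icc 1 ⌊δ * (g*m*n:ℕ)⌋₊, dsf (m*n) c := by
  have h := ds_cnt_le g m n hg hm hn δ
  have h' : (dsCnt (g*m) (g*n) δ : ℝ) ≤ _ := Nat.cast_le.2 h
  rw [Nat.cast_sum, ds_sumsym] at h'
  refine h'.trans ?_
  apply add_le_add
  · have := ds_sol_zero g m n hmn
    have : ((dsSol g m n 0).card : ℝ) ≤ _ := Nat.cast_le.2 this
    refine this.trans (le_of_eq ?_)
    split_ifs <;> simp
  · rw [mul_sum]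
    apply sum_le_sum
    intro c hc
    have hc := (mem_Icc.1 hc).1
    have a1 := ds_sol_card g m n hg hm hn hmn (c:ℤ) (by omega)
    have a2 := ds_sol_card g m n hg hm hn hmn (-(c:ℤ)) (by omega)
    rw [Int.natAbs_neg] at a2
    rw [Int.natAbs_natCast] at a1 a2
    linarith

lemma ds_pair (A : ℝ) (hA : 0 < A) : ∃ C : ℝ, 0 < C ∧ ∀ (m n H K : ℕ) (r s : ℝ), 1 ≤ m → 1 ≤ n → m * n ≤ 2^H → 2 ≤ H → 1 ≤ K →
    4^K ≤ H → Real.log H ≤ A * K → 0 ≤ r → 0 ≤ s →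
    ∑ k ∈ range K, (4:ℝ)^k * ((2 * min r s / 2^k) * dsCnt m n (2 * max r s / 2^k)) ≤
      (if m = n then 2 * s * Nat.totient n * 2^K else 0) + C * K * (r * Nat.totient m) * (s * Nat.totient n) := by
  obtain ⟨C, hC, h⟩ := ds_star A hA
  refine ⟨8 * C, by positivity, ?_⟩
  intro m0 n0 H K r s hm0 hn0 hmnH hH hK hKH hlog hr hs
  obtain ⟨g, m, n, hg, hmn, rfl, rfl⟩ := Nat.exists_coprime' (m := m0) (n := n0) (Nat.gcd_pos_of_pos_left _ hm0)
  rw [mul_comm m g, mul_comm n g] at *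
  have hm : 0 < m := Nat.pos_of_mul_pos_left hm0
  have hn : 0 < n := Nat.pos_of_mul_pos_left hn0
  have hN : m * n ≤ 2^H := by
    refine le_trans ?_ hmnH
    exact Nat.mul_le_mul (Nat.le_mul_of_pos_left _ hg) (Nat.le_mul_of_pos_left _ hg)
  set D := 2 * max r s * (g*m*n:ℕ) with hD
  have hmax : 0 ≤ max r s := le_max_of_le_left hr
  have hmin : 0 ≤ min r s := le_min hr hs
  have hst := h (m*n) H K D (Nat.mul_pos hm hn) hN hH hK hKH hlog (by positivity)
  set P0 := (g:ℝ) * ((Nat.totient (g*m):ℝ) / (g*m:ℕ)) * ((Nat.totient (g*n):ℝ) / (g*n:ℕ)) with hP0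
  set Z := (if g * m = g * n then (Nat.totient (g*n):ℝ) else 0) with hZ
  have hZ0 : 0 ≤ Z := by rw [hZ]; split_ifs <;> positivity
  have hP00 : 0 ≤ P0 := by positivity
  calc _ ≤ ∑ k ∈ range K, (4:ℝ)^k * ((2 * min r s / 2^k) * (Z + 2 * (P0 * (((m*n:ℕ):ℝ) / Nat.totient (m*n))) * ∑ c ∈ Icc 1 ⌊D/2^k⌋₊, dsf (m*n) c)) := by
        apply sum_le_sum
        intro k _
        gcongr
        have := ds_cnt_real g m n hg hm hn hmn (2 * max r s / 2^k)
        rwa [show 2 * max r s / 2^k * (g*m*n:ℕ) = D / 2^k by rw [hD]; ring] at this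
    _ = 2 * min r s * Z * ∑ k ∈ range K, (2:ℝ)^k + 4 * min r s * P0 * ((((m*n:ℕ):ℝ) / Nat.totient (m*n)) * ∑ k ∈ range K, (2:ℝ)^k * ∑ c ∈ Icc 1 ⌊D/2^k⌋₊, dsf (m*n) c) := by
        simp only [mul_sum (range K)]
        rw [← sum_add_distrib]
        apply sum_congr rfl
        intro k _
        have : (4:ℝ)^k = 2^k * 2^k := by rw [← mul_pow]; norm_num
        rw [this]
        field_simp
        ring
    _ ≤ 2 * s * Z * 2^K + 4 * min r s * P0 * (C * K * D) := by
        have : ∑ k ∈ range K, (2:ℝ)^k ≤ 2^K := by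
          rw [geom_sum_eq (by norm_num)]; norm_num
        have := min_le_right r s
        gcongr
    _ = _ := by
        have e1 : 2 * s * Z * 2^K = (if g * m = g * n then 2 * s * Nat.totient (g*n) * 2^K else 0) := by
          rw [hZ]; split_ifs <;> simp
        rw [e1]
        congr 1
        have q1 : (0:ℝ) < g := by exact_mod_cast hg
        have q2 : (0:ℝ) < m := by exact_mod_cast hm
        have q3 : (0:ℝ) < n := by exact_mod_cast hn
        have e2 : P0 * (g*m*n:ℕ) = Nat.totient (g*m) * Nat.totient (g*n) := by
          rw [hP0]; push_cast; field_simp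
        have e3 : min r s * max r s = r * s := min_mul_max r s
        calc 4 * min r s * P0 * (C * K * D) = 8 * C * K * (min r s * max r s) * (P0 * (g*m*n:ℕ)) := by rw [hD]; ring
          _ = _ := by rw [e2, e3]; ring

lemma ds_CS {α ι : Type*} [MeasurableSpace α] (μ : Measure α) [IsFiniteMeasure μ] (I : Finset ι) (S : ι → Set α)
    (hS : ∀ i, MeasurableSet (S i)) (Q : ℝ) (hQ0 : 0 < Q) (hM : 0 < ∑ i ∈ I, μ.real (S i))
    (hQ : ∑ i ∈ I, ∑ j ∈ I, μ.real (S i ∩ S j) ≤ Q) :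
    (∑ i ∈ I, μ.real (S i))^2 ≤ Q * μ.real (⋃ i ∈ I, S i) := by
  classical
  set M := ∑ i ∈ I, μ.real (S i) with hMd
  set U := ⋃ i ∈ I, S i with hU
  have hUm : MeasurableSet U := Finset.measurableSet_biUnion _ (fun i _ => hS i)
  have int : ∀ s : Set α, MeasurableSet s → Integrable (s.indicator (fun _ => (1:ℝ))) μ := fun s hs =>
    (integrable_const 1).indicator hs
  have key : ∀ t : ℝ, 2 * t * M ≤ Q + t^2 * μ.real U := by
    intro t
    have h1 : ∫ x, (2 * t * ∑ i ∈ I, (S i).indicator (fun _ => (1:ℝ)) x) ∂μ ≤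
        ∫ x, ((∑ i ∈ I, ∑ j ∈ I, (S i ∩ S j).indicator (fun _ => (1:ℝ)) x) + t^2 * U.indicator (fun _ => (1:ℝ)) x) ∂μ := by
      apply integral_mono
      · exact (integrable_finsetSum _ (fun i _ => int _ (hS i))).const_mul _
      · exact (integrable_finsetSum _ (fun i _ => integrable_finsetSum _ (fun j _ => int _ ((hS i).inter (hS j))))).add ((int _ hUm).const_mul _)
      · intro x
        simp only
        have e : ∑ i ∈ I, ∑ j ∈ I, (S i ∩ S j).indicator (fun _ => (1:ℝ)) x = (∑ i ∈ I, (S i).indicator (fun _ => (1:ℝ)) x)^2 := by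
          rw [sq, sum_mul_sum]
          apply sum_congr rfl; intro i _
          apply sum_congr rfl; intro j _
          by_cases h1 : x ∈ S i <;> by_cases h2 : x ∈ S j <;> simp [h1, h2]
        rw [e]
        by_cases hx : x ∈ U
        · rw [Set.indicator_of_mem hx]
          nlinarith [sq_nonneg ((∑ i ∈ I, (S i).indicator (fun _ => (1:ℝ)) x) - t)]
        · have : ∑ i ∈ I, (S i).indicator (fun _ => (1:ℝ)) x = 0 := by
            apply sum_eq_zero
            intro i hi
            apply Set.indicator_of_notMem
            intro h; exact hx (Set.mem_biUnion hi h)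
          rw [this, Set.indicator_of_notMem hx]; simp
    rw [integral_const_mul, integral_finsetSum _ (fun i _ => int _ (hS i)), integral_add, integral_finsetSum, integral_const_mul,
      integral_indicator_const _ hUm] at h1
    · simp only [integral_indicator_const _ (hS _)] at h1
      have e : ∀ i ∈ I, ∫ x, ∑ j ∈ I, (S i ∩ S j).indicator (fun _ => (1:ℝ)) x ∂μ = ∑ j ∈ I, μ.real (S i ∩ S j) := by
        intro i _
        rw [integral_finsetSum _ (fun j _ => int _ ((hS i).inter (hS j)))]
        apply sum_congr rfl
        intro j _
        rw [integral_indicator_const _ ((hS i).inter (hS j))]; simp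
      rw [sum_congr rfl e] at h1
      simp only [smul_eq_mul, mul_one] at h1
      linarith
    · exact (fun i _ => integrable_finsetSum _ (fun j _ => int _ ((hS i).inter (hS j))))
    · exact (integrable_finsetSum _ (fun i _ => integrable_finsetSum _ (fun j _ => int _ ((hS i).inter (hS j)))))
    · exact ((int _ hUm).const_mul _)
  have h := key (Q / M)
  have e1 : 2 * (Q/M) * M = 2 * Q := by field_simp
  rw [e1] at h
  have h2 : Q ≤ (Q/M)^2 * μ.real U := by linarith
  rw [div_pow, div_mul_eq_mul_div, le_div_iff₀ (by positivity)] at h2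
  have : Q * M^2 ≤ Q * (Q * μ.real U) := by nlinarith
  exact le_of_mul_le_mul_left this hQ0

lemma ds_vol_ball (x : UnitAddCircle) (ρ : ℝ) (h0 : 0 ≤ ρ) : volume.real (Metric.ball x ρ) = min 1 (2*ρ) := by
  rw [Measure.real, ← measure_congr (AddCircle.closedBall_ae_eq_ball (T := 1)), AddCircle.volume_closedBall, ENNReal.toReal_ofReal]
  positivity

lemma ds_vol_inter (x y : UnitAddCircle) (ρ σ : ℝ) (h0 : 0 ≤ ρ) (h1 : 0 ≤ σ) :
    volume.real (Metric.ball x ρ ∩ Metric.ball y σ) ≤ if ‖x - y‖ < 2 * max ρ σ then 2 * min ρ σ else 0 := by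
  split_ifs with h
  · rw [mul_min_of_nonneg _ _ (by norm_num)]
    apply le_min
    · refine (measureReal_mono Set.inter_subset_left).trans ?_
      rw [ds_vol_ball _ _ h0]; exact min_le_right _ _
    · refine (measureReal_mono Set.inter_subset_right).trans ?_
      rw [ds_vol_ball _ _ h1]; exact min_le_right _ _
  · have : Metric.ball x ρ ∩ Metric.ball y σ = ∅ := by
      rw [← Set.disjoint_iff_inter_eq_empty]
      apply Metric.ball_disjoint_ball
      rw [dist_eq_norm]
      have := le_max_left ρ σ
      have := le_max_right ρ σ
      linarith
    rw [this]; simp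

lemma ds_block (A : ℝ) (hA : 0 < A) : ∃ c0 : ℝ, 0 < c0 ∧ ∀ (B : Finset ℕ) (r : ℕ → ℝ) (H K : ℕ),
    (∀ n ∈ B, 1 ≤ n ∧ 0 ≤ r n ∧ r n ≤ 1/2) → (∀ m ∈ B, ∀ n ∈ B, m * n ≤ 2^H) → 2 ≤ H → 1 ≤ K →
    4^K ≤ H → Real.log H ≤ A * K → (2:ℝ)^K ≤ ∑ n ∈ B, r n * Nat.totient n →
    c0 ≤ volume.real (⋃ n ∈ B, ⋃ a ∈ dsR n, Metric.ball (((a:ℝ)/n : ℝ) : UnitAddCircle) (r n)) := by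
  obtain ⟨C, hC, hp⟩ := ds_pair A hA
  refine ⟨4 / (2 + C), by positivity, ?_⟩
  intro B r H K hB hBH hH hK hKH hlog hT
  set T := ∑ n ∈ B, r n * Nat.totient n with hTdef
  have hT0 : 0 < T := lt_of_lt_of_le (by positivity) hT
  let q : ℕ → ℝ := fun k => ∑ m ∈ B, ∑ n ∈ B, (2 * min (r m) (r n) / 2^k) * dsCnt m n (2 * max (r m) (r n) / 2^k)
  have hq : ∑ k ∈ range K, (4:ℝ)^k * q k ≤ ∑ k ∈ range K, (2 + C) * T^2 := by
    calc ∑ k ∈ range K, (4:ℝ)^k * q k = ∑ m ∈ B, ∑ n ∈ B, ∑ k ∈ range K, (4:ℝ)^k * ((2 * min (r m) (r n) / 2^k) * dsCnt m n (2 * max (r m) (r n) / 2^k)) := by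
          simp only [q, mul_sum]
          rw [sum_comm]
          apply sum_congr rfl; intro m _
          rw [sum_comm]
      _ ≤ ∑ m ∈ B, ∑ n ∈ B, ((if m = n then 2 * r n * Nat.totient n * 2^K else 0) + C * K * (r m * Nat.totient m) * (r n * Nat.totient n)) := by
          apply sum_le_sum; intro m hm
          apply sum_le_sum; intro n hn
          exact hp m n H K (r m) (r n) (hB m hm).1 (hB n hn).1 (hBH m hm n hn) hH hK hKH hlog (hB m hm).2.1 (hB n hn).2.1
      _ = 2 * T * 2^K + C * K * T^2 := by
          simp only [sum_add_distrib]
          congr 1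
          · rw [hTdef, mul_sum, sum_mul]
            apply sum_congr rfl
            intro m hm
            rw [sum_ite_eq, if_pos hm]; ring
          · simp only [← mul_sum, ← sum_mul]; ring
      _ ≤ 2 * T * T + C * K * T^2 := by gcongr
      _ ≤ _ := by
          rw [sum_const, card_range, nsmul_eq_mul]
          have : (1:ℝ) ≤ K := by exact_mod_cast hK
          nlinarith [mul_nonneg (sub_nonneg.2 this) (sq_nonneg T)]
  obtain ⟨k, hk, hqk⟩ := exists_le_of_sum_le (nonempty_range_iff.2 (by omega)) hq
  set I := B.sigma dsR
  let S : (Σ _ : ℕ, ℕ) → Set UnitAddCircle := fun i => Metric.ball (((i.2:ℝ)/i.1 : ℝ) : UnitAddCircle) (r i.1 / 2^k)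
  have h2k : (1:ℝ) ≤ 2^k := one_le_pow₀ (by norm_num)
  have hM : ∑ i ∈ I, volume.real (S i) = 2 * T / 2^k := by
    rw [sum_sigma, hTdef, mul_sum, sum_div]
    apply sum_congr rfl
    intro n hn
    obtain ⟨h1, h2, h3⟩ := hB n hn
    have : ∀ a ∈ dsR n, volume.real (S ⟨n, a⟩) = 2 * (r n / 2^k) := by
      intro a _
      simp only [S]
      rw [ds_vol_ball _ _ (by positivity), min_eq_right]
      have : r n / 2^k ≤ r n := div_le_self h2 h2k
      linarith
    rw [sum_congr rfl this, sum_const, dsR_card, nsmul_eq_mul]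
    ring
  have hQ : ∑ i ∈ I, ∑ j ∈ I, volume.real (S i ∩ S j) ≤ q k := by
    simp only [I, sum_sigma, q]
    apply sum_le_sum; intro m hm
    rw [sum_comm]
    apply sum_le_sum; intro n hn
    obtain ⟨h1, h2, h3⟩ := hB n hn
    obtain ⟨h1', h2', h3'⟩ := hB m hm
    rw [dsCnt, card_filter, Nat.cast_sum, mul_sum, sum_product]
    apply sum_le_sum; intro a ha
    apply sum_le_sum; intro b hb
    refine (ds_vol_inter _ _ _ _ (by positivity) (by positivity)).trans (le_of_eq ?_)
    simp only
    rw [max_div_div_right (by positivity), min_div_div_right (by positivity), ← mul_div_assoc, ← mul_div_assoc]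
    split_ifs <;> simp
  have hcs := ds_CS volume I S (fun i => measurableSet_ball) ((2+C) * T^2 / 4^k) (by positivity) (by rw [hM]; positivity)
    (hQ.trans (by rw [le_div_iff₀ (by positivity)]; linarith))
  have h4 : (4:ℝ)^k = 2^k * 2^k := by rw [← mul_pow]; norm_num
  have hcs2 : 4 ≤ (2+C) * volume.real (⋃ i ∈ I, S i) := by
    rw [hM, h4] at hcs
    have e : (2 * T / 2^k)^2 = (T^2 / (2^k * 2^k)) * 4 := by ring
    have e2 : (2+C) * T^2 / (2^k * 2^k) * volume.real (⋃ i ∈ I, S i) = (T^2 / (2^k * 2^k)) * ((2+C) * volume.real (⋃ i ∈ I, S i)) := by ring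
    rw [e, e2] at hcs
    exact le_of_mul_le_mul_left hcs (by positivity)
  rw [div_le_iff₀ (by positivity), mul_comm]
  refine hcs2.trans ?_
  gcongr
  · exact measure_ne_top _ _
  intro x hx
  simp only [Set.mem_iUnion] at hx ⊢
  obtain ⟨i, hi, hx⟩ := hx
  rw [mem_sigma] at hi
  refine ⟨i.1, hi.1, i.2, hi.2, Metric.ball_subset_ball (div_le_self (hB _ hi.1).2.1 h2k) hx⟩



lemma ds_flog_pos (x : ℝ) : 0 < flog x := lt_of_lt_of_le one_pos (le_max_left _ _)

lemma ds_totlow : ∃ C : ℝ, 0 < C ∧ ∀ n : ℕ, 2 ≤ n → (n:ℝ) / Nat.totient n ≤ C * Real.log n := by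
  obtain ⟨C, hC, h⟩ := ds_L4
  refine ⟨C, hC, fun n hn => ?_⟩
  have h1 := h n n (by omega) hn Nat.lt_two_pow_self.le
  refine le_trans ?_ h1
  have : 1 ≤ dsS n n := by
    rw [dsS]
    have : (1:ℕ) ∈ (Icc 1 n).filter (fun c => Nat.Coprime c n) := by simp; omega
    calc (1:ℝ) = 1 / (Nat.totient 1 : ℝ) := by simp
      _ ≤ _ := single_le_sum (f := fun c : ℕ => 1 / (Nat.totient c : ℝ)) (fun i _ => by positivity) this
  exact le_mul_of_one_le_right (by positivity) this

lemma ds_big (ε : ℝ) : ∀ᶠ n : ℕ in atTop, 1 ≤ √(n:ℝ) * ((Nat.totient n : ℝ) / n) / flog n ^ ε := by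
  obtain ⟨C, hC, h⟩ := ds_totlow
  have h1 := (isLittleO_log_rpow_rpow_atTop (1+ε) (show (0:ℝ) < 1/2 by norm_num)).def (show (0:ℝ) < C⁻¹ by positivity)
  have h2 := tendsto_natCast_atTop_atTop (R := ℝ) |>.eventually h1
  filter_upwards [h2, eventually_ge_atTop 3] with n hn hn3
  have hn3' : (3:ℝ) ≤ n := by exact_mod_cast hn3
  have hl : 1 ≤ Real.log n := by
    rw [Real.le_log_iff_exp_le (by linarith)]
    linarith [Real.exp_one_lt_d9]
  have hfl : flog n = Real.log n := max_eq_right hl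
  have hn0 : (0:ℝ) < n := by linarith
  have ht : (0:ℝ) < Nat.totient n := by exact_mod_cast Nat.totient_pos.2 (by omega)
  have hl0 : 0 < Real.log n := by linarith
  rw [Real.norm_of_nonneg (by positivity), Real.norm_of_nonneg (by positivity), ← Real.sqrt_eq_rpow, Real.rpow_add hl0, Real.rpow_one] at hn
  have h3 := h n (by omega)
  rw [hfl, le_div_iff₀ (by positivity), one_mul]
  rw [inv_mul_eq_div, le_div_iff₀ hC] at hn
  have h4 : 1 ≤ C * Real.log n * ((Nat.totient n : ℝ) / n) := by
    calc (1:ℝ) = (n:ℝ) / Nat.totient n * ((Nat.totient n : ℝ) / n) := by field_simp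
      _ ≤ _ := by gcongr
  calc Real.log n ^ ε = Real.log n ^ ε * 1 := by ring
    _ ≤ Real.log n ^ ε * (C * Real.log n * ((Nat.totient n : ℝ) / n)) := by gcongr
    _ = (Real.log n * Real.log n ^ ε * C) * ((Nat.totient n : ℝ) / n) := by ring
    _ ≤ _ := by gcongr

lemma ds_cap (ψ : ℕ → ℝ) (ε : ℝ)
    (hdiv : ¬ Summable (fun n : ℕ => ψ n * (Nat.totient n : ℝ) / (n * flog n ^ ε))) :
    ¬ Summable (fun n : ℕ => (min (ψ n) (√(n:ℝ)) / n) * (Nat.totient n : ℝ) / flog n ^ ε) := by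
  intro hs
  apply hdiv
  have ht := hs.tendsto_atTop_zero
  have h1 := ht.eventually (gt_mem_nhds (show (0:ℝ) < 1 by norm_num))
  refine (summable_congr_cofinite ?_).1 hs
  rw [Nat.cofinite_eq_atTop]
  filter_upwards [h1, ds_big ε] with n hn hn2
  rcases le_total (ψ n) (√(n:ℝ)) with h | h
  · rw [min_eq_left h, ← div_div]; ring
  · exfalso
    rw [min_eq_right h] at hn
    have : √(n:ℝ) / n * (Nat.totient n : ℝ) / flog n ^ ε = √(n:ℝ) * ((Nat.totient n : ℝ) / n) / flog n ^ ε := by ring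
    linarith

noncomputable def dsF (j : ℕ) : Finset ℕ := (range (2^(2^(j+1)))).filter (fun n => Nat.log 2 (Nat.log 2 n) = j)

lemma ds_memF (n : ℕ) : n ∈ dsF (Nat.log 2 (Nat.log 2 n)) := by
  rw [dsF, mem_filter, mem_range]
  refine ⟨?_, rfl⟩
  have h1 : n < 2^(Nat.log 2 n + 1) := Nat.lt_pow_succ_log_self (by norm_num) n
  have h2 : Nat.log 2 n < 2^(Nat.log 2 (Nat.log 2 n) + 1) := Nat.lt_pow_succ_log_self (by norm_num) _
  exact h1.trans_le (Nat.pow_le_pow_right (by norm_num) h2)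

lemma ds_F_low (j n : ℕ) (hj : 1 ≤ j) (hn : n ∈ dsF j) : 2^(2^j) ≤ n := by
  rw [dsF, mem_filter] at hn
  have h1 : Nat.log 2 n ≠ 0 := by
    intro h; rw [h] at hn; simp at hn; omega
  have h0 : n ≠ 0 := by
    rintro rfl; simp at h1
  have h2 := Nat.pow_log_le_self 2 h1
  rw [hn.2] at h2
  exact (Nat.pow_le_pow_right (by norm_num) h2).trans (Nat.pow_log_le_self 2 h0)

lemma ds_select (r : ℕ → ℝ) (hr : ∀ n, 0 ≤ r n) (ε : ℝ) (hε : 0 < ε) (q : ℕ) (hq : 1 ≤ q) (hqε : (1:ℝ)/q ≤ ε/2)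
    (hdiv : ¬ Summable (fun n : ℕ => r n * (Nat.totient n : ℝ) / flog n ^ ε)) :
    ∃ᶠ j : ℕ in atTop, (2:ℝ)^(j/q+1) ≤ ∑ n ∈ dsF j, r n * Nat.totient n := by
  by_contra hcon
  rw [not_frequently] at hcon
  apply hdiv
  set a : ℕ → ℝ := fun n : ℕ => r n * (Nat.totient n : ℝ) / flog n ^ ε with ha
  have ha0 : ∀ n, 0 ≤ a n := by
    intro n
    have := hr n
    have := ds_flog_pos n
    simp only [ha]; positivity
  set b : ℕ → ℝ := fun j => ∑ n ∈ dsF j, a n with hb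
  have hb0 : ∀ j, 0 ≤ b j := fun j => sum_nonneg (fun n _ => ha0 n)
  have hbs : Summable b := by
    have hgeo : Summable (fun j : ℕ => (2 * (2:ℝ)^ε) * ((2:ℝ)^(-(ε/2)))^j) := by
      apply Summable.mul_left
      apply summable_geometric_of_lt_one (by positivity)
      apply Real.rpow_lt_one_of_one_lt_of_neg (by norm_num) (by linarith)
    apply Summable.of_norm_bounded_eventually_nat hgeo
    filter_upwards [hcon, eventually_ge_atTop 1] with j hj hj1
    rw [Real.norm_of_nonneg (hb0 j)]
    push Not at hj
    have h1 : b j ≤ (∑ n ∈ dsF j, r n * Nat.totient n) / ((2:ℝ)^j/2)^ε := by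
      rw [sum_div]
      apply sum_le_sum
      intro n hn
      have hlow := ds_F_low j n hj1 hn
      have hlow' : (2:ℝ)^(2^j) ≤ n := by exact_mod_cast hlow
      have : (2:ℝ)^j/2 ≤ flog n := by
        refine le_trans ?_ (le_max_right _ _)
        have h := Real.log_le_log (by positivity) hlow'
        rw [Real.log_pow] at h
        push_cast at h
        have := Real.log_two_gt_d9
        have : (0:ℝ) < 2^j := by positivity
        nlinarith
      have := hr n
      simp only [ha]
      gcongr
    refine h1.trans ?_
    calc _ ≤ (2:ℝ)^(j/q+1) / ((2:ℝ)^j/2)^ε := by gcongr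
      _ ≤ _ := by
        have e1 : (2:ℝ)^(j/q+1) = 2 * (2:ℝ)^(((j/q:ℕ)):ℝ) := by
          rw [Real.rpow_natCast]; ring
        have e2 : ((2:ℝ)^j/2)^ε = (2:ℝ)^(j*ε) / 2^ε := by
          rw [Real.div_rpow (by positivity) (by positivity), ← Real.rpow_natCast, ← Real.rpow_mul (by norm_num)]
        have e3 : ((2:ℝ)^(-(ε/2)))^j = (2:ℝ)^(-(ε/2)*j) := by
          rw [← Real.rpow_natCast, ← Real.rpow_mul (by norm_num)]
        have e4 : ((j/q:ℕ):ℝ) ≤ j * ε - (ε/2)*j := by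
          have : ((j/q:ℕ):ℝ) ≤ j/q := Nat.cast_div_le
          have h5 : (j:ℝ)/q = j * (1/q) := by ring
          have : (j:ℝ) * (1/q) ≤ j * (ε/2) := by gcongr
          linarith
        rw [e1, e2, e3, div_div_eq_mul_div, div_le_iff₀ (by positivity)]
        have e5 : (2:ℝ)^(((j/q:ℕ)):ℝ) ≤ (2:ℝ)^(-(ε/2)*j) * (2:ℝ)^(j*ε) := by
          rw [← Real.rpow_add (by norm_num)]
          apply Real.rpow_le_rpow_of_exponent_le (by norm_num)
          linarith
        have e6 : (0:ℝ) < 2^ε := by positivity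
        nlinarith
  apply summable_of_sum_le ha0 (c := ∑' j, b j)
  intro u
  classical
  rw [← sum_fiberwise_of_maps_to (g := fun n => Nat.log 2 (Nat.log 2 n)) (t := u.image (fun n => Nat.log 2 (Nat.log 2 n)))
    (fun n hn => mem_image_of_mem _ hn)]
  refine le_trans (sum_le_sum (g := b) ?_) (hbs.sum_le_tsum _ (fun j _ => hb0 j))
  intro j _
  apply sum_le_sum_of_subset_of_nonneg
  · intro n hn
    rw [mem_filter] at hn
    rw [← hn.2]; exact ds_memF n
  · intro n _ _; exact ha0 n

lemma ds_sub (ψ : ℕ → ℝ) (n : ℕ) (hn : 2 ≤ n) (x : UnitAddCircle) (m : ℕ) (hm : m < n) (hg : Nat.gcd m n = 1)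
    (δ : ℝ) (hδ : δ ≤ ψ n / n) (hx : ‖x - ((((m:ℝ)/n:ℝ)) : UnitAddCircle)‖ < δ) : x ∈ E ψ n := by
  have hm0 : 1 ≤ m := by
    rcases Nat.eq_zero_or_pos m with rfl | h
    · simp at hg; omega
    · exact h
  obtain ⟨y, rfl⟩ := QuotientAddGroup.mk_surjective x
  have hn0 : (0:ℝ) < n := by exact_mod_cast (by omega : 0 < n)
  rw [← QuotientAddGroup.mk_sub] at hx
  change ‖(((y - (m:ℝ)/n) : ℝ) : UnitAddCircle)‖ < δ at hx
  rw [UnitAddCircle.norm_eq] at hx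
  set k := round (y - (m:ℝ)/n)
  have hx2 := abs_lt.1 (hx.trans_le hδ)
  rw [E, Set.mem_iUnion₂]
  refine ⟨m, by rw [mem_filter, mem_Icc]; exact ⟨⟨hm0, hm.le⟩, hg⟩, y - k, ⟨?_, ?_⟩, ?_⟩
  · rw [sub_div]; linarith
  · rw [add_div]; linarith
  · change (((y - k : ℝ)) : UnitAddCircle) = ((y : ℝ) : UnitAddCircle)
    rw [AddCircle.coe_sub]
    have : ((k:ℝ) : UnitAddCircle) = 0 := by
      have := AddCircle.coe_zsmul (p := (1:ℝ)) (n := k) (x := 1)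
      simp only [zsmul_eq_mul, mul_one] at this
      rw [this]
      have h1 : ((1:ℝ):UnitAddCircle) = 0 := AddCircle.coe_period 1
      rw [h1]; simp
    rw [this, sub_zero]

/-- The Duffin–Schaeffer conjecture with extra divergence `(log n)^ε`. -/
theorem duffin_schaeffer_extra_divergence (ψ : ℕ → ℝ) (hψ : ∀ n, 0 ≤ ψ n)
    (ε : ℝ) (hε : 0 < ε)
    (hdiv : ¬ Summable (fun n : ℕ => ψ n * (Nat.totient n : ℝ) / (n * flog n ^ ε))) :
    volume (W ψ) = 1 := by
  have hdiv' := ds_cap ψ ε hdiv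
  set r : ℕ → ℝ := fun n => min (ψ n) (√(n:ℝ)) / n with hrdef
  have hr0 : ∀ n, 0 ≤ r n := fun n => div_nonneg (le_min (hψ n) (Real.sqrt_nonneg _)) (Nat.cast_nonneg _)
  have hr1 : ∀ n : ℕ, r n ≤ 1 / √(n:ℝ) := by
    intro n
    have : r n ≤ √(n:ℝ) / n := by simp only [hrdef]; gcongr; exact min_le_right _ _
    rwa [Real.sqrt_div_self'] at this
  have hrψ : ∀ n : ℕ, r n ≤ ψ n / n := by
    intro n; simp only [hrdef]; gcongr; exact min_le_left _ _
  have hrt : Tendsto r atTop (nhds 0) := by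
    apply squeeze_zero hr0 hr1
    have h1 : Tendsto (fun n : ℕ => √(n:ℝ)) atTop atTop := Real.tendsto_sqrt_atTop.comp tendsto_natCast_atTop_atTop
    have h2 := h1.inv_tendsto_atTop
    simp only [one_div]
    exact h2
  obtain ⟨q0, hq0⟩ := exists_nat_gt (2/ε)
  set q := q0 + 2 with hqd
  have hqε : (1:ℝ)/q ≤ ε/2 := by
    have : 2/ε ≤ (q:ℝ) := by rw [hqd]; push_cast; linarith
    rw [div_le_iff₀ hε] at this
    have hq0 : (0:ℝ) < q := by rw [hqd]; positivity
    rw [div_le_div_iff₀ hq0 (by norm_num)]; linarith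
  have hsel := ds_select r hr0 ε hε q (by omega) hqε hdiv'
  obtain ⟨c0, hc0, hblock⟩ := ds_block (q+2) (by positivity)
  let S : ℕ → Set UnitAddCircle := fun n => ⋃ a ∈ dsR n, Metric.ball (((a:ℝ)/n : ℝ) : UnitAddCircle) (r n)
  have hSm : ∀ n, MeasurableSet (S n) := fun n => Finset.measurableSet_biUnion _ (fun a _ => measurableSet_ball)
  let V : ℕ → Set UnitAddCircle := fun N => ⋃ n ∈ Set.Ici N, S n
  have hVm : ∀ N, MeasurableSet (V N) := fun N => MeasurableSet.biUnion (Set.to_countable _) (fun n _ => hSm n)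
  have hVanti : Antitone V := by
    intro M N h
    exact Set.biUnion_subset_biUnion_left (Set.Ici_subset_Ici.2 h)
  have hV : ∀ N, ENNReal.ofReal c0 ≤ volume (V N) := by
    intro N
    obtain ⟨j, hj, hjT⟩ := (frequently_atTop.1 hsel) (N+1)
    have hj1 : 1 ≤ j := by omega
    have hjp : j < 2^j := Nat.lt_two_pow_self
    have h := hblock (dsF j) r (2^(j+2)) (j/q+1) ?_ ?_ ?_ ?_ ?_ ?_ hjT
    · rw [ENNReal.ofReal_le_iff_le_toReal (measure_ne_top _ _)]
      refine h.trans (measureReal_mono ?_ (measure_ne_top _ _))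
      intro x hx
      rw [Set.mem_iUnion₂] at hx ⊢
      obtain ⟨n, hn, hx⟩ := hx
      refine ⟨n, ?_, hx⟩
      have := ds_F_low j n hj1 hn
      have : 2^j < 2^(2^j) := Nat.lt_two_pow_self
      rw [Set.mem_Ici]; omega
    · intro n hn
      have h1 := ds_F_low j n hj1 hn
      have h2 : 2^2 ≤ 2^(2^j) := Nat.pow_le_pow_right (by norm_num) (by omega)
      have h4 : (4:ℝ) ≤ n := by exact_mod_cast (by omega : 4 ≤ n)
      refine ⟨by omega, hr0 n, (hr1 n).trans ?_⟩
      have : (2:ℝ) ≤ √(n:ℝ) := Real.le_sqrt_of_sq_le (by linarith)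
      gcongr
    · intro m hm n hn
      rw [dsF, mem_filter, mem_range] at hm hn
      calc m * n ≤ 2^(2^(j+1)) * 2^(2^(j+1)) := Nat.mul_le_mul hm.1.le hn.1.le
        _ = 2^(2^(j+2)) := by rw [← pow_add]; congr 1; ring
    · have : 2^1 ≤ 2^(j+2) := Nat.pow_le_pow_right (by norm_num) (by omega)
      omega
    · exact Nat.succ_le_succ (Nat.zero_le _)
    · rw [show 4 = 2^2 by norm_num, ← pow_mul]
      apply Nat.pow_le_pow_right (by norm_num)
      have h2 : q * (j/q) ≤ j := Nat.mul_div_le j q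
      have : 2 * (j/q) ≤ q * (j/q) := Nat.mul_le_mul_right _ (by omega)
      omega
    · push_cast
      rw [Real.log_pow]
      have h3 : j < q * (j/q+1) := Nat.lt_mul_div_succ j (by omega)
      have h3' : (j:ℝ) ≤ q * ((j/q:ℕ)+1) := by exact_mod_cast h3.le
      have h4 : (0:ℝ) ≤ ((j/q:ℕ):ℝ) := Nat.cast_nonneg _
      have h5 := Real.log_two_lt_d9
      have h6 : (0:ℝ) ≤ (j:ℝ) := Nat.cast_nonneg _
      push_cast at h3' h4 ⊢
      nlinarith
  have hInt : ENNReal.ofReal c0 ≤ volume (⋂ N, V N) := by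
    have := tendsto_measure_iInter_atTop (μ := (volume : Measure UnitAddCircle)) (fun N => (hVm N).nullMeasurableSet) hVanti ⟨0, measure_ne_top _ _⟩
    exact ge_of_tendsto' this hV
  have hsub : (⋂ N, V N) ⊆ addWellApproximable UnitAddCircle r := by
    intro x hx
    rw [UnitAddCircle.mem_addWellApproximable_iff, ← Nat.frequently_atTop_iff_infinite, frequently_atTop]
    intro N
    have := Set.mem_iInter.1 hx N
    rw [Set.mem_iUnion₂] at this
    obtain ⟨n, hn, hx⟩ := this
    rw [Set.mem_iUnion₂] at hx
    obtain ⟨a, ha, hx⟩ := hx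
    rw [dsR, mem_filter, mem_range] at ha
    refine ⟨n, hn, a, ha.1, ha.2, ?_⟩
    rwa [Metric.mem_ball, dist_eq_norm] at hx
  rcases AddCircle.addWellApproximable_ae_empty_or_univ (T := (1:ℝ)) r hrt with h | h
  · exfalso
    have h0 := measure_eq_zero_iff_ae_notMem.2 h
    have := hInt.trans (measure_mono hsub)
    rw [h0] at this
    simp at this
    linarith
  · have hW : ∀ᵐ x : UnitAddCircle, x ∈ W ψ := by
      filter_upwards [h] with x hx
      rw [UnitAddCircle.mem_addWellApproximable_iff, ← Nat.frequently_atTop_iff_infinite] at hx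
      refine (hx.and_eventually (eventually_ge_atTop 2)).mono ?_
      rintro n ⟨⟨m, hm, hg, hx⟩, hn⟩
      exact ds_sub ψ n hn x m hm hg (r n) (hrψ n) hx
    have he : W ψ =ᵐ[volume] Set.univ := eventuallyEq_univ.2 hW
    rw [measure_congr he]
    exact UnitAddCircle.measure_univ
end

section
/- There is an absolute constant C > 0 with the following property. Let ψ: ℕ → ℝ be non-negative and let m ≠ n be positive integers with 0 < ψ(m) ≤ 1/2 and 0 < ψ(n) ≤ 1/2 (so that λ(E_m(ψ))·λ(E_n(ψ)) ≠ 0). Put D(m,n) = max(n·ψ(m), m·ψ(n)) / gcd(m,n). Then λ(E_m(ψ) ∩ E_n(ψ)) / (λ(E_m(ψ))·λ(E_n(ψ))) ≤ C · ∏_{p prime, p | mn/gcd(m,n)², p > D(m,n)} (1 − 1/p)^{−1}. -/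
open MeasureTheory Filter Finset

section analytic
open ArithmeticFunction

lemma pv_mertens1 (N : ℕ) (hN : 1 ≤ N) :
    ∑ d ∈ Ioc 0 N, vonMangoldt d / d ≤ Real.log N + (Real.log 4 + 4) := by
  have h1 := sum_Ioc_mul_zeta_eq_sum vonMangoldt N
  rw [vonMangoldt_mul_zeta] at h1
  have hpsi := Chebyshev.psi_le_const_mul_self (x := (N:ℝ)) (by positivity)
  simp only [Chebyshev.psi, Nat.floor_natCast] at hpsi
  have hlog : ∑ n ∈ Ioc 0 N, ArithmeticFunction.log n ≤ N * Real.log N := by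
    calc _ ≤ ∑ n ∈ Ioc 0 N, Real.log N := by
          apply sum_le_sum
          intro n hn
          rw [mem_Ioc] at hn
          rw [log_apply]
          apply Real.log_le_log
          · exact_mod_cast hn.1
          · exact_mod_cast hn.2
      _ = _ := by simp
  have hNpos : (0:ℝ) < N := by exact_mod_cast hN
  have h2 : (N:ℝ) * ∑ d ∈ Ioc 0 N, vonMangoldt d / d ≤
      ∑ d ∈ Ioc 0 N, vonMangoldt d * ((N / d : ℕ) : ℝ) + ∑ d ∈ Ioc 0 N, vonMangoldt d := by
    rw [mul_sum, ← sum_add_distrib]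
    apply sum_le_sum
    intro d hd
    rw [mem_Ioc] at hd
    have hdpos : (0:ℝ) < d := by exact_mod_cast hd.1
    have h3 : (N:ℝ) / d ≤ ((N / d : ℕ) : ℝ) + 1 := by
      rw [div_le_iff₀ hdpos]
      have : N < (N / d + 1) * d := by
        have := Nat.lt_div_mul_add (a := N) (b := d) hd.1
        linarith
      exact_mod_cast this.le
    calc (N:ℝ) * (vonMangoldt d / d) = vonMangoldt d * ((N:ℝ) / d) := by ring
      _ ≤ vonMangoldt d * (((N / d : ℕ) : ℝ) + 1) :=
        mul_le_mul_of_nonneg_left h3 vonMangoldt_nonneg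
      _ = _ := by ring
  have h4 : (N:ℝ) * ∑ d ∈ Ioc 0 N, vonMangoldt d / d ≤
      N * (Real.log N + (Real.log 4 + 4)) := by
    rw [← h1] at h2
    linarith
  exact le_of_mul_le_mul_left h4 hNpos

lemma pv_mertens2 : ∃ K : ℝ, ∀ N : ℕ, 2 ≤ N →
    ∑ d ∈ (Ioc 0 N).filter Nat.Prime, (1:ℝ) / d ≤ Real.log (Real.log N) + K := by
  set c := Real.log 4 + 4 with hc
  set A : ℕ → ℝ := fun N => ∑ d ∈ (Ioc 0 N).filter Nat.Prime, Real.log d / d with hA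
  set B : ℕ → ℝ := fun N => ∑ d ∈ (Ioc 0 N).filter Nat.Prime, (1:ℝ) / d with hB
  have hAle : ∀ N, 1 ≤ N → A N ≤ Real.log N + c := by
    intro N hN
    refine le_trans ?_ (pv_mertens1 N hN)
    calc A N = ∑ d ∈ (Ioc 0 N).filter Nat.Prime, vonMangoldt d / d := by
          apply sum_congr rfl
          intro d hd
          rw [vonMangoldt_apply_prime (mem_filter.1 hd).2]
      _ ≤ _ := by
          apply sum_le_sum_of_subset_of_nonneg (filter_subset _ _)
          intro i _ _
          exact div_nonneg vonMangoldt_nonneg (by positivity)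
  have hstep : ∀ N, 1 ≤ N → B (N+1) - A (N+1) / Real.log ((N+1 : ℕ) : ℝ)
      = B N - A N / Real.log ((N+1 : ℕ) : ℝ) := by
    intro N hN
    have hl : Real.log ((N+1 : ℕ) : ℝ) ≠ 0 := by
      apply ne_of_gt
      apply Real.log_pos
      exact_mod_cast (by omega : 1 < N+1)
    simp only [hA, hB]
    rw [← Finset.insert_Ioc_right_eq_Ioc_add_one (by omega : 0 ≤ N), filter_insert]
    split_ifs with hp
    · rw [sum_insert (by simp), sum_insert (by simp), add_div, div_right_comm, div_self hl]
      ring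
    · rfl
  have key : ∀ N : ℕ, 2 ≤ N → B N - A N / Real.log N ≤
      Real.log (Real.log N) - c / Real.log N + (c / Real.log 2 - Real.log (Real.log 2)) := by
    intro N hN
    induction N, hN using Nat.le_induction with
    | base =>
      have : (Ioc 0 2).filter Nat.Prime = {2} := by decide
      simp only [hA, hB, this, sum_singleton]
      have : Real.log 2 ≠ 0 := by
        apply ne_of_gt; apply Real.log_pos; norm_num
      push_cast
      rw [div_right_comm, div_self this]
      linarith
    | succ N hN ih =>
      rw [hstep N (by omega)]
      have ha := hAle N (by omega)
      have hlN : 0 < Real.log (N:ℝ) := Real.log_pos (by exact_mod_cast (by omega : 1 < N))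
      have hlN1 : Real.log (N:ℝ) ≤ Real.log ((N+1 : ℕ):ℝ) := by
        apply Real.log_le_log
        · exact_mod_cast (by omega : 0 < N)
        · push_cast; linarith
      set u := Real.log (N:ℝ)
      set v := Real.log ((N+1 : ℕ):ℝ)
      have hv : 0 < v := by linarith
      have h1 : A N * (1/u - 1/v) ≤ (u + c) * (1/u - 1/v) := by
        apply mul_le_mul_of_nonneg_right ha
        have := one_div_le_one_div_of_le hlN hlN1
        linarith
      have h2 : 1 - u / v ≤ Real.log v - Real.log u := by
        have := Real.log_le_sub_one_of_pos (div_pos hlN hv)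
        rw [Real.log_div hlN.ne' hv.ne'] at this
        linarith
      have h3 : (u + c) * (1/u - 1/v) = 1 - u/v + c/u - c/v := by
        field_simp
        ring
      have h4 : A N * (1/u - 1/v) = A N / u - A N / v := by ring
      linarith
  refine ⟨1 + (c / Real.log 2 - Real.log (Real.log 2)), fun N hN => ?_⟩
  have h1 := key N hN
  have h2 := hAle N (by omega)
  have hlN : 0 < Real.log (N:ℝ) := Real.log_pos (by exact_mod_cast (by omega : 1 < N))
  have h3 : A N / Real.log N ≤ 1 + c / Real.log N := by
    rw [div_le_iff₀ hlN, add_mul, div_mul_cancel₀ _ hlN.ne']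
    linarith
  change B N ≤ _
  linarith

lemma pv_telescope (N : ℕ) (hN : 1 ≤ N) :
    ∑ d ∈ Ioc 1 N, (1:ℝ) / (d * (d - 1)) = 1 - 1 / N := by
  induction N, hN using Nat.le_induction with
  | base => simp
  | succ N hN ih =>
    rw [← Finset.insert_Ioc_right_eq_Ioc_add_one (by omega : 1 ≤ N), sum_insert (by simp), ih]
    have : (0:ℝ) < N := by exact_mod_cast hN
    push_cast
    have h2 : (N:ℝ) + 1 - 1 = N := by ring
    rw [h2]
    field_simp
    ring

lemma pv_sum_prime_le (N : ℕ) (s : Finset ℕ) (hs : s ⊆ (Ioc 0 N).filter Nat.Prime) :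
    ∑ d ∈ s, (1:ℝ) / (d * (d - 1)) ≤ 1 := by
  rcases Nat.eq_zero_or_pos N with rfl | hN
  · simp at hs; simp [hs]
  calc _ ≤ ∑ d ∈ Ioc 1 N, (1:ℝ) / (d * (d - 1)) := by
        apply sum_le_sum_of_subset_of_nonneg
        · intro d hd
          have := hs hd
          simp only [mem_filter, mem_Ioc] at this ⊢
          exact ⟨this.2.one_lt, this.1.2⟩
        · intro d hd _
          rw [mem_Ioc] at hd
          have : (1:ℝ) < d := by exact_mod_cast hd.1
          apply div_nonneg zero_le_one
          apply mul_nonneg <;> linarith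
    _ = _ := pv_telescope N hN
    _ ≤ 1 := by
      have : (0:ℝ) ≤ 1 / N := by positivity
      linarith

lemma pv_mertens3 : ∃ K : ℝ, 0 < K ∧ ∀ N : ℕ, 1 ≤ N →
    ∏ d ∈ (Ioc 0 N).filter Nat.Prime, (1 - 1 / (d:ℝ))⁻¹ ≤ K * (1 + Real.log N) := by
  obtain ⟨K, hK⟩ := pv_mertens2
  refine ⟨max 1 (Real.exp (K+1)), by positivity, fun N hN => ?_⟩
  have hl0 : 0 ≤ Real.log (N:ℝ) := Real.log_nonneg (by exact_mod_cast hN)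
  rcases hN.eq_or_lt with rfl | hN2
  · have : (Ioc 0 1).filter Nat.Prime = ∅ := by decide
    rw [this]; simp
  have hN2 : 2 ≤ N := hN2
  have hlN : 0 < Real.log (N:ℝ) := Real.log_pos (by exact_mod_cast (by omega : 1 < N))
  calc _ ≤ ∏ d ∈ (Ioc 0 N).filter Nat.Prime, Real.exp (1 / d + 1 / (d * (d-1))) := by
        apply Finset.prod_le_prod
        · intro d hd
          have : (1:ℝ) < d := by exact_mod_cast (mem_filter.1 hd).2.one_lt
          rw [inv_nonneg, sub_nonneg, div_le_one (by linarith)]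
          linarith
        · intro d hd
          have : (1:ℝ) < d := by exact_mod_cast (mem_filter.1 hd).2.one_lt
          have h1 : (1 - 1 / (d:ℝ))⁻¹ = (1 / d + 1 / (d * (d-1))) + 1 := by
            have : (d:ℝ) - 1 ≠ 0 := by linarith
            have : (d:ℝ) ≠ 0 := by linarith
            field_simp
            ring
          rw [h1]
          exact Real.add_one_le_exp _
    _ = Real.exp (∑ d ∈ (Ioc 0 N).filter Nat.Prime, (1:ℝ) / d +
          ∑ d ∈ (Ioc 0 N).filter Nat.Prime, (1:ℝ) / (d * (d-1))) := by
        rw [← Real.exp_sum, sum_add_distrib]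
    _ ≤ Real.exp (Real.log (Real.log N) + (K + 1)) := by
        apply Real.exp_le_exp.2
        have h1 := hK N hN2
        have h2 := pv_sum_prime_le N _ (Subset.refl _)
        linarith
    _ = Real.exp (K+1) * Real.log N := by
        rw [Real.exp_add, Real.exp_log hlN, mul_comm]
    _ ≤ _ := by
        apply mul_le_mul (le_max_right _ _) (by linarith) hl0 (by positivity)

/-- the multiplicative weight -/
noncomputable def pvF (P : ℕ) : ArithmeticFunction ℝ :=
  ⟨fun n => if n.Coprime P then (n:ℝ) / Nat.totient n else 0, by simp⟩

lemma pvF_apply (P n : ℕ) : pvF P n = if n.Coprime P then (n:ℝ) / Nat.totient n else 0 := rfl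

lemma pvF_nonneg (P n : ℕ) : 0 ≤ pvF P n := by
  rw [pvF_apply]; split_ifs <;> positivity

lemma pvF_mul (P d e : ℕ) (hd : IsPrimePow d) : pvF P (d * e) ≤ 2 * pvF P e := by
  rcases Nat.eq_zero_or_pos e with rfl | he
  · simp
  rw [pvF_apply, pvF_apply]
  by_cases h : (d * e).Coprime P
  · rw [if_pos h, if_pos (Nat.Coprime.coprime_mul_left h)]
    obtain ⟨p, k, hp, hk, rfl⟩ := hd
    have hp := hp.nat_prime
    have h1 := Nat.totient_super_multiplicative (p^k) e
    have h2 : p ^ k ≤ 2 * Nat.totient (p^k) := by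
      rw [Nat.totient_prime_pow hp hk]
      obtain ⟨j, rfl⟩ : ∃ j, k = j + 1 := ⟨k-1, by omega⟩
      rw [Nat.add_sub_cancel, pow_succ]
      have : p ≤ 2 * (p - 1) := by have := hp.two_le; omega
      calc p ^ j * p ≤ p ^ j * (2 * (p - 1)) := Nat.mul_le_mul_left _ this
        _ = _ := by ring
    have hpos : 0 < Nat.totient (p^k) := Nat.totient_pos.2 (pow_pos hp.pos k)
    have hpose : 0 < Nat.totient e := Nat.totient_pos.2 he
    have h3 : 0 < Nat.totient (p^k * e) := Nat.totient_pos.2 (mul_pos (pow_pos hp.pos k) he)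
    rw [← mul_div_assoc, div_le_div_iff₀ (by exact_mod_cast h3) (by exact_mod_cast hpose)]
    have : p^k * e * e.totient ≤ 2 * e * (p^k*e).totient := by
      calc p^k * e * e.totient ≤ (2 * Nat.totient (p^k)) * e * e.totient := by gcongr
        _ = 2 * e * (Nat.totient (p^k) * e.totient) := by ring
        _ ≤ _ := Nat.mul_le_mul_left _ h1
    exact_mod_cast this
  · rw [if_neg h]
    split_ifs <;> positivity

lemma pv_HR (P N : ℕ) (hN : 1 ≤ N) :
    (∑ r ∈ Ioc 0 N, pvF P r) * (1 + Real.log N) ≤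
      (2 + 2 * (Real.log 4 + 4)) * (N * ∑ r ∈ Ioc 0 N, pvF P r / r) := by
  have hNpos : (0:ℝ) < N := by exact_mod_cast hN
  have h1 : ∑ r ∈ Ioc 0 N, pvF P r * Real.log r ≤ 2 * ∑ r ∈ Ioc 0 N, (pvF P * vonMangoldt) r := by
    rw [mul_sum]
    apply sum_le_sum
    intro r hr
    rw [mul_comm (pvF P) vonMangoldt, mul_apply, ← vonMangoldt_sum, mul_sum, mul_sum,
      Nat.sum_divisorsAntidiagonal (fun i j => 2 * (vonMangoldt i * pvF P j))]
    apply sum_le_sum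
    intro d hd
    by_cases hp : IsPrimePow d
    · have := pvF_mul P d (r / d) hp
      rw [Nat.mul_div_cancel' (Nat.dvd_of_mem_divisors hd)] at this
      calc _ ≤ (2 * pvF P (r/d)) * vonMangoldt d :=
            mul_le_mul_of_nonneg_right this vonMangoldt_nonneg
        _ = _ := by ring
    · rw [vonMangoldt_eq_zero_iff.2 hp]; simp
  have h2 : ∑ r ∈ Ioc 0 N, (pvF P * vonMangoldt) r ≤
      (Real.log 4 + 4) * (N * ∑ r ∈ Ioc 0 N, pvF P r / r) := by
    rw [sum_Ioc_mul_eq_sum_sum, mul_sum, mul_sum]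
    apply sum_le_sum
    intro r hr
    rw [mem_Ioc] at hr
    have hpsi := Chebyshev.psi_le_const_mul_self (x := ((N / r : ℕ):ℝ)) (by positivity)
    simp only [Chebyshev.psi, Nat.floor_natCast] at hpsi
    have h3 : ((N / r : ℕ):ℝ) ≤ (N:ℝ) / r := Nat.cast_div_le
    have h4 : (0:ℝ) ≤ Real.log 4 + 4 := by
      have := Real.log_nonneg (x := 4) (by norm_num); linarith
    calc _ ≤ pvF P r * ((Real.log 4 + 4) * ((N:ℝ) / r)) := by
          apply mul_le_mul_of_nonneg_left _ (pvF_nonneg P r)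
          exact hpsi.trans (mul_le_mul_of_nonneg_left h3 h4)
      _ = _ := by ring
  have h5 : (∑ r ∈ Ioc 0 N, pvF P r) * (1 + Real.log N) ≤
      2 * (N * ∑ r ∈ Ioc 0 N, pvF P r / r) + ∑ r ∈ Ioc 0 N, pvF P r * Real.log r := by
    rw [mul_sum, mul_sum, sum_mul, ← sum_add_distrib]
    apply sum_le_sum
    intro r hr
    rw [mem_Ioc] at hr
    have hr0 : (0:ℝ) < r := by exact_mod_cast hr.1
    have hrN : (r:ℝ) ≤ N := by exact_mod_cast hr.2
    have h6 : Real.log N - Real.log r ≤ N / r - 1 := by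
      rw [← Real.log_div hNpos.ne' hr0.ne']
      exact Real.log_le_sub_one_of_pos (by positivity)
    have h7 : 1 + Real.log N ≤ 2 * (N / r) + Real.log r := by
      have : 0 ≤ (N:ℝ)/r := by positivity
      linarith
    calc _ ≤ pvF P r * (2 * (N / r) + Real.log r) :=
          mul_le_mul_of_nonneg_left h7 (pvF_nonneg P r)
      _ = _ := by ring
  linarith


lemma pv_euler_factor (p : ℕ) (hp : p.Prime) :
    HasSum (fun n : ℕ => (1:ℝ) / Nat.totient (p^n)) (1 + (p:ℝ) / ((p:ℝ)-1)^2) := by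
  have hp1 : (1:ℝ) < p := by exact_mod_cast hp.one_lt
  have hp0 : (p:ℝ) - 1 ≠ 0 := by linarith
  have hp0' : (p:ℝ) ≠ 0 := by linarith
  have h := (hasSum_geometric_of_lt_one (r := (1:ℝ)/p) (by positivity)
    (by rw [div_lt_one (by linarith)]; exact hp1)).mul_left ((1:ℝ)/(p-1))
  have h1 : ∀ n : ℕ, (1:ℝ)/(p-1) * ((1:ℝ)/p)^n = (1:ℝ) / Nat.totient (p^(n+1)) := by
    intro n
    rw [Nat.totient_prime_pow_succ hp, Nat.cast_mul, Nat.cast_pow, Nat.cast_pred hp.pos,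
      div_pow, one_pow]
    field_simp
  have h3 : (1:ℝ)/(p-1) * (1 - 1/(p:ℝ))⁻¹ = (p:ℝ) / ((p:ℝ)-1)^2 := by
    field_simp
  simp_rw [h1] at h
  rw [h3] at h
  have h2 := (hasSum_nat_add_iff (f := fun n : ℕ => (1:ℝ) / Nat.totient (p^n)) 1).1 h
  simpa [add_comm] using h2

lemma pv_euler (P N : ℕ) :
    ∑ r ∈ Ioc 0 N, pvF P r / r ≤
      ∏ p ∈ ((Ioc 0 N).filter Nat.Prime).filter (fun p => ¬ p ∣ P),
        (1 + (p:ℝ) / ((p:ℝ)-1)^2) := by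
  set s := ((Ioc 0 N).filter Nat.Prime).filter (fun p => ¬ p ∣ P) with hs
  obtain ⟨f, hf⟩ : ∃ f : ℕ → ℝ, f = fun n : ℕ => (1:ℝ) / Nat.totient n := ⟨_, rfl⟩
  have hf' : ∀ n, f n = (1:ℝ) / Nat.totient n := fun n => by rw [hf]
  have hfn : ∀ n, 0 ≤ f n := fun n => by rw [hf']; positivity
  have hff : ∀ p : ℕ, p.Prime → HasSum (fun n : ℕ => f (p^n)) (1 + (p:ℝ) / ((p:ℝ)-1)^2) := by
    intro p hp
    simp_rw [hf']
    exact pv_euler_factor p hp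
  have h := (EulerProduct.summable_and_hasSum_factoredNumbers_prod_filter_prime_tsum
    (f := f) (by rw [hf']; simp)
    (by intro m n hmn; rw [hf', hf', hf', Nat.totient_mul hmn]; push_cast; rw [one_div_mul_one_div])
    (fun {p} hp => (hff p hp).summable.norm) s).2
  have hsf : s.filter Nat.Prime = s := by
    apply filter_true_of_mem
    intro p hp
    simp only [hs, mem_filter] at hp
    exact hp.1.2
  rw [hsf] at h
  have h2 : ∏ p ∈ s, ∑' n : ℕ, f (p^n) =
      ∏ p ∈ s, (1 + (p:ℝ) / ((p:ℝ)-1)^2) := by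
    apply prod_congr rfl
    intro p hp
    simp only [hs, mem_filter] at hp
    exact (hff p hp.1.2).tsum_eq
  rw [h2] at h
  have h3 : HasSum (Set.indicator (Nat.factoredNumbers s) f) _ := hasSum_subtype_iff_indicator.1 h
  have h4 : ∀ i, 0 ≤ Set.indicator (Nat.factoredNumbers s) f i :=
    fun i => Set.indicator_nonneg (fun x _ => hfn x) i
  refine le_trans (sum_le_sum (fun r hr => ?_)) (sum_le_hasSum (Ioc 0 N) (fun i _ => h4 i) h3)
  rw [mem_Ioc] at hr
  rw [pvF_apply]
  split_ifs with hc
  · rw [Set.indicator_of_mem]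
    · have hr0 : (0:ℝ) < r := by exact_mod_cast hr.1
      have : (0:ℝ) < Nat.totient r := by exact_mod_cast Nat.totient_pos.2 hr.1
      apply le_of_eq
      rw [hf']
      field_simp
    · apply Nat.mem_factoredNumbers_of_primeFactors_subset (by omega)
      intro p hp
      have hpp := Nat.prime_of_mem_primeFactors hp
      have hpr := Nat.dvd_of_mem_primeFactors hp
      simp only [hs, mem_filter, mem_Ioc]
      refine ⟨⟨⟨hpp.pos, (Nat.le_of_dvd hr.1 hpr).trans hr.2⟩, hpp⟩, fun hpP => ?_⟩
      exact hpp.one_lt.ne' (Nat.eq_one_of_dvd_coprimes hc hpr hpP)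
  · simp only [zero_div]
    exact h4 r

lemma pv_sieve : ∃ C : ℝ, 0 < C ∧ ∀ P N : ℕ, 1 ≤ P → 1 ≤ N →
    ∑ r ∈ Ioc 0 N, pvF P r ≤
      C * (N * ∏ p ∈ P.primeFactors.filter (fun p => p ≤ N), (1 - 1 / (p:ℝ))) := by
  obtain ⟨K, hK, hM⟩ := pv_mertens3
  have hc0 : (0:ℝ) ≤ Real.log 4 + 4 := by
      have := Real.log_nonneg (x := 4) (by norm_num); linarith
  refine ⟨(2 + 2 * (Real.log 4 + 4)) * (Real.exp 1 * K), by positivity, fun P N hP hN => ?_⟩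
  have hlog : 0 < 1 + Real.log (N:ℝ) := by
    have := Real.log_nonneg (x := (N:ℝ)) (by exact_mod_cast hN)
    linarith
  have hNpos : (0:ℝ) < N := by exact_mod_cast hN
  have hHR := pv_HR P N hN
  have hE := pv_euler P N
  set s := (Ioc 0 N).filter Nat.Prime with hs
  have hsp : ∀ p ∈ s, (1:ℝ) < p := fun p hp => by
    exact_mod_cast (mem_filter.1 hp).2.one_lt
  have h1 : ∏ p ∈ s.filter (fun p => ¬ p ∣ P), (1 + (p:ℝ) / ((p:ℝ)-1)^2) ≤
      Real.exp 1 * ∏ p ∈ s.filter (fun p => ¬ p ∣ P), (1 - 1 / (p:ℝ))⁻¹ := by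
    calc _ ≤ ∏ p ∈ s.filter (fun p => ¬ p ∣ P),
          (Real.exp ((1:ℝ) / (p * (p-1))) * (1 - 1 / (p:ℝ))⁻¹) := by
          apply Finset.prod_le_prod
          · intro p hp
            positivity
          · intro p hp
            have hp1 := hsp p (mem_filter.1 hp).1
            have hp0 : (p:ℝ) - 1 ≠ 0 := by linarith
            have hp0' : (p:ℝ) ≠ 0 := by linarith
            have h2 : 1 + (p:ℝ) / ((p:ℝ)-1)^2 =
                ((1:ℝ) / (p * (p-1)) + 1) * (1 - 1 / (p:ℝ))⁻¹ := by
              field_simp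
              ring
            rw [h2]
            apply mul_le_mul_of_nonneg_right (Real.add_one_le_exp _)
            rw [inv_nonneg, sub_nonneg, div_le_one (by linarith)]
            linarith
      _ = Real.exp (∑ p ∈ s.filter (fun p => ¬ p ∣ P), (1:ℝ) / (p * (p-1))) *
            ∏ p ∈ s.filter (fun p => ¬ p ∣ P), (1 - 1 / (p:ℝ))⁻¹ := by
          rw [prod_mul_distrib, Real.exp_sum]
      _ ≤ _ := by
          apply mul_le_mul_of_nonneg_right
          · apply Real.exp_le_exp.2
            exact pv_sum_prime_le N _ (filter_subset _ _)
          · apply prod_nonneg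
            intro p hp
            have hp1 := hsp p (mem_filter.1 hp).1
            rw [inv_nonneg, sub_nonneg, div_le_one (by linarith)]
            linarith
  have h3 : P.primeFactors.filter (fun p => p ≤ N) = s.filter (fun p => p ∣ P) := by
    ext p
    simp only [hs, mem_filter, Nat.mem_primeFactors, mem_Ioc]
    constructor
    · rintro ⟨⟨h1, h2, h3⟩, h4⟩
      exact ⟨⟨⟨h1.pos, h4⟩, h1⟩, h2⟩
    · rintro ⟨⟨⟨h1, h4⟩, h2⟩, h3⟩
      exact ⟨⟨h2, h3, by omega⟩, h4⟩
  have h4 : ∏ p ∈ s.filter (fun p => ¬ p ∣ P), (1 - 1 / (p:ℝ))⁻¹ =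
      (∏ p ∈ s, (1 - 1 / (p:ℝ))⁻¹) * ∏ p ∈ s.filter (fun p => p ∣ P), (1 - 1 / (p:ℝ)) := by
    rw [← prod_filter_mul_prod_filter_not s (fun p => p ∣ P), mul_right_comm,
      ← prod_mul_distrib]
    symm
    convert one_mul _
    apply prod_eq_one
    intro p hp
    have hp1 := hsp p (mem_filter.1 hp).1
    apply inv_mul_cancel₀
    have : 1 / (p:ℝ) < 1 := by rw [div_lt_one (by linarith)]; exact hp1
    linarith
  rw [h3]
  set Q := ∏ p ∈ s.filter (fun p => p ∣ P), (1 - 1 / (p:ℝ)) with hQ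
  have hQ0 : 0 ≤ Q := by
    apply prod_nonneg
    intro p hp
    have hp1 := hsp p (mem_filter.1 hp).1
    rw [sub_nonneg, div_le_one (by linarith)]
    linarith
  have h5 : ∑ r ∈ Ioc 0 N, pvF P r / r ≤ Real.exp 1 * ((K * (1 + Real.log N)) * Q) := by
    refine hE.trans (h1.trans ?_)
    rw [h4]
    have := hM N hN
    gcongr
  have h6 : (∑ r ∈ Ioc 0 N, pvF P r) * (1 + Real.log N) ≤
      ((2 + 2 * (Real.log 4 + 4)) * (Real.exp 1 * K) * (N * Q)) * (1 + Real.log N) := by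
    refine hHR.trans ?_
    calc _ ≤ (2 + 2 * (Real.log 4 + 4)) *
          (N * (Real.exp 1 * ((K * (1 + Real.log N)) * Q))) := by gcongr
      _ = _ := by ring
  exact le_of_mul_le_mul_right h6 hlog

end analytic

section counting

open Classical in
lemma pv_crt {G : Type*} [Fintype G] [AddCommGroup G] (S : Finset ℕ) (π : ∀ p : ℕ, G → ZMod p)
    (B : ∀ p : ℕ, Set (ZMod p)) (c : ℕ → ℝ)
    (hadd : ∀ p ∈ S, ∀ x y, π p (x + y) = π p x + π p y)
    (hu : ∀ p ∈ S, ∃ u, π p u = 1 ∧ ∀ q ∈ S, q ≠ p → π q u = 0)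
    (hprime : ∀ p ∈ S, p.Prime)
    (hB : ∀ p ∈ S, c p ≤ ((B p).ncard : ℝ)) :
    (((Finset.univ : Finset G).filter (fun x => ∀ p ∈ S, π p x ∉ B p)).card : ℝ) ≤
      Fintype.card G * ∏ p ∈ S, (1 - c p / p) := by
  induction S using Finset.induction_on with
  | empty => simp
  | insert p S hpS ih =>
    have ih' := ih (fun q hq => hadd q (mem_insert_of_mem hq))
      (fun q hq => by
        obtain ⟨u, h1, h2⟩ := hu q (mem_insert_of_mem hq)
        exact ⟨u, h1, fun q' hq' => h2 q' (mem_insert_of_mem hq')⟩)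
      (fun q hq => hprime q (mem_insert_of_mem hq)) (fun q hq => hB q (mem_insert_of_mem hq))
    have hp := hprime p (mem_insert_self p S)
    have : Fact p.Prime := ⟨hp⟩
    have : NeZero p := ⟨hp.ne_zero⟩
    have hBp := hB p (mem_insert_self p S)
    obtain ⟨u, hu1, hu2⟩ := hu p (mem_insert_self p S)
    set A := (Finset.univ : Finset G).filter (fun x => ∀ q ∈ S, π q x ∉ B q) with hA
    have hsmul : ∀ q ∈ insert p S, ∀ (k : ℕ) (x : G), π q (k • u + x) = k * π q u + π q x := by
      intro q hq k x
      induction k with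
      | zero => simp
      | succ k ihk =>
        rw [succ_nsmul', add_assoc, hadd q hq, ihk]
        push_cast; ring
    have hfib : ∀ b : ZMod p, (A.filter (fun x => π p x = b)).card =
        (A.filter (fun x => π p x = 0)).card := by
      intro b
      symm
      apply Finset.card_bij (fun x _ => b.val • u + x)
      · intro x hx
        simp only [hA, mem_filter, Finset.mem_univ, true_and] at hx ⊢
        refine ⟨fun q hq => ?_, ?_⟩
        · rw [hsmul q (mem_insert_of_mem hq), hu2 q (mem_insert_of_mem hq)
            (fun h => hpS (h ▸ hq)), mul_zero, zero_add]
          exact hx.1 q hq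
        · rw [hsmul p (mem_insert_self p S), hu1, hx.2]; simp
      · intro x _ y _ h
        exact add_left_cancel h
      · intro y hy
        simp only [hA, mem_filter, Finset.mem_univ, true_and] at hy
        have hz : ∀ q ∈ insert p S, π q y = b.val * π q u + π q (y - b.val • u) := by
          intro q hq
          rw [← hsmul q hq]; congr 1; abel
        refine ⟨y - b.val • u, ?_, by abel⟩
        simp only [hA, mem_filter, Finset.mem_univ, true_and]
        refine ⟨fun q hq => ?_, ?_⟩
        · have := hz q (mem_insert_of_mem hq)
          rw [hu2 q (mem_insert_of_mem hq) (fun h => hpS (h ▸ hq)), mul_zero, zero_add] at this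
          rw [← this]; exact hy.1 q hq
        · have := hz p (mem_insert_self p S)
          rw [hu1, hy.2] at this
          simpa using this.symm
    set k := (A.filter (fun x => π p x = 0)).card with hk
    have hAcard : A.card = p * k := by
      rw [Finset.card_eq_sum_card_fiberwise (f := π p) (t := Finset.univ) (by intro x _; simp)]
      simp [hfib, ZMod.card]
    have hBc : (B p).ncard = (B p).toFinset.card := Set.ncard_eq_toFinset_card' _
    have hBle : (B p).toFinset.card ≤ p := by
      calc _ ≤ Fintype.card (ZMod p) := Finset.card_le_univ _
        _ = p := ZMod.card p
    have hnew : ((Finset.univ : Finset G).filter (fun x => ∀ q ∈ insert p S, π q x ∉ B q)).card =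
        (p - (B p).toFinset.card) * k := by
      rw [Finset.card_eq_sum_card_fiberwise (f := π p) (t := (B p).toFinsetᶜ)]
      · rw [Finset.sum_congr rfl (g := fun _ => k)]
        · simp [Finset.card_compl, ZMod.card]
        · intro b hb
          rw [← hfib b]
          congr 1
          ext x
          simp only [hA, mem_filter, Finset.mem_univ, true_and, Finset.forall_mem_insert]
          simp only [Finset.mem_compl, Set.mem_toFinset] at hb
          constructor
          · rintro ⟨⟨h1, h2⟩, h3⟩
            exact ⟨h2, h3⟩
          · rintro ⟨h1, h3⟩
            exact ⟨⟨h3 ▸ hb, h1⟩, h3⟩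
      · intro x hx
        simp only [Finset.coe_filter, Finset.mem_univ, true_and, Set.mem_ofPred_eq,
          Finset.forall_mem_insert] at hx
        simpa using hx.1
    have hp0 : (0:ℝ) < p := by exact_mod_cast hp.pos
    rw [prod_insert hpS, hnew]
    push_cast [hBle]
    have hcp : c p / p ≤ 1 := by
      rw [div_le_one hp0]
      refine hBp.trans ?_
      rw [hBc]; exact_mod_cast hBle
    have hAcard' : (A.card : ℝ) = p * k := by exact_mod_cast hAcard
    calc ((p:ℝ) - ((B p).toFinset.card : ℝ)) * k ≤ (p - c p) * k := by
          rw [hBc] at hBp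
          gcongr
      _ = (1 - c p / p) * A.card := by
          rw [hAcard']; field_simp
      _ ≤ (1 - c p / p) * (Fintype.card G * ∏ q ∈ S, (1 - c q / q)) :=
          mul_le_mul_of_nonneg_left ih' (by linarith)
      _ = _ := by ring

lemma pv_totient_ratio (r : ℕ) (hr : r ≠ 0) :
    ((Nat.totient r : ℝ)) / r = ∏ p ∈ r.primeFactors, (1 - 1 / (p:ℝ)) := by
  have h := Nat.totient_eq_mul_prod_factors r
  have h2 : ((Nat.totient r : ℚ) : ℝ) = ((r * ∏ p ∈ r.primeFactors, (1 - (p:ℚ)⁻¹) : ℚ) : ℝ) := by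
    rw [h]
  push_cast at h2
  rw [h2]
  have : (r:ℝ) ≠ 0 := by exact_mod_cast hr
  rw [mul_div_cancel_left₀ _ this]
  simp

lemma pv_pos {p : ℕ} (hp : p.Prime) : 0 < 1 - 1 / (p:ℝ) := by
  have : (1:ℝ) < p := by exact_mod_cast hp.one_lt
  rw [sub_pos, div_lt_one (by linarith)]; exact this

lemma pv_local (g P r : ℕ) (hr : r ≠ 0) :
    ∏ p ∈ g.primeFactors, (1 - (if p ∣ P ∨ p ∣ r then (1:ℝ) else 2) / p) ≤
      (∏ p ∈ g.primeFactors, (1 - 1 / (p:ℝ))) *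
      (∏ p ∈ g.primeFactors.filter (fun p => ¬ p ∣ P), (1 - 1 / (p:ℝ))) *
      ((r:ℝ) / Nat.totient r) := by
  have h1 : (r:ℝ) / Nat.totient r = ∏ p ∈ r.primeFactors, (1 - 1 / (p:ℝ))⁻¹ := by
    rw [prod_inv_distrib, ← pv_totient_ratio r hr, inv_div]
  have h2 : ∏ p ∈ g.primeFactors.filter (fun p => p ∣ r), (1 - 1 / (p:ℝ))⁻¹ ≤
      ∏ p ∈ r.primeFactors, (1 - 1 / (p:ℝ))⁻¹ := by
    have hsub : g.primeFactors.filter (fun p => p ∣ r) ⊆ r.primeFactors := by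
      intro p hp
      simp only [mem_filter, Nat.mem_primeFactors] at hp ⊢
      exact ⟨hp.1.1, hp.2, hr⟩
    rw [← prod_sdiff hsub]
    apply le_mul_of_one_le_left
    · apply prod_nonneg
      intro p hp
      exact inv_nonneg.2 (pv_pos (Nat.prime_of_mem_primeFactors (hsub hp))).le
    · calc (1:ℝ) = ∏ p ∈ r.primeFactors \ g.primeFactors.filter (fun p => p ∣ r), 1 := by simp
        _ ≤ _ := by
          apply Finset.prod_le_prod (by simp)
          intro p hp
          have hp := Nat.prime_of_mem_primeFactors (mem_sdiff.1 hp).1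
          apply (one_le_inv₀ (pv_pos hp)).2
          have : (0:ℝ) ≤ 1 / p := by positivity
          linarith
  calc _ ≤ ∏ p ∈ g.primeFactors, ((1 - 1 / (p:ℝ)) * (if ¬ p ∣ P then (1 - 1 / (p:ℝ)) else 1) *
          (if p ∣ r then (1 - 1 / (p:ℝ))⁻¹ else 1)) := by
        apply Finset.prod_le_prod
        · intro p hp
          have hp := Nat.prime_of_mem_primeFactors hp
          have : (2:ℝ) ≤ p := by exact_mod_cast hp.two_le
          rw [sub_nonneg, div_le_one (by linarith)]
          split_ifs <;> linarith
        · intro p hp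
          have hp := Nat.prime_of_mem_primeFactors hp
          have h0 := pv_pos hp
          have h3 : (0:ℝ) ≤ 1 / p := by positivity
          by_cases hP : p ∣ P <;> by_cases hpr : p ∣ r
          · simp only [hP, hpr, or_self, if_true, not_true, if_false, mul_one]
            apply le_mul_of_one_le_right h0.le
            apply (one_le_inv₀ h0).2
            linarith
          · simp [hP, hpr]
          · simp only [hP, hpr, or_true, if_true, not_false_iff]
            rw [mul_assoc, mul_inv_cancel₀ h0.ne', mul_one]
          · simp only [hP, hpr, or_self, if_true, not_false_iff, if_false, mul_one]
            have : (2:ℝ) / p = 2 * (1 / p) := by ring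
            rw [this]
            nlinarith [sq_nonneg (1 / (p:ℝ))]
    _ = (∏ p ∈ g.primeFactors, (1 - 1 / (p:ℝ))) *
      (∏ p ∈ g.primeFactors.filter (fun p => ¬ p ∣ P), (1 - 1 / (p:ℝ))) *
      ∏ p ∈ g.primeFactors.filter (fun p => p ∣ r), (1 - 1 / (p:ℝ))⁻¹ := by
        rw [prod_mul_distrib, prod_mul_distrib, ← prod_filter, ← prod_filter]
    _ ≤ _ := by
        rw [h1]
        apply mul_le_mul_of_nonneg_left h2
        apply mul_nonneg <;> apply prod_nonneg
        · intro p hp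
          exact (pv_pos (Nat.prime_of_mem_primeFactors hp)).le
        · intro p hp
          exact (pv_pos (Nat.prime_of_mem_primeFactors (mem_filter.1 hp).1)).le

lemma pv_count_r (g m' n' : ℕ) (hg : 0 < g) (hm : 0 < m') (hn : 0 < n')
    (hco : m'.Coprime n') (h1 : m' * n' ≠ 1) (r : ℤ) :
    ((((Icc 1 (g*m')).filter (fun a => Nat.Coprime a (g*m')) ×ˢ
      (Icc 1 (g*n')).filter (fun b => Nat.Coprime b (g*n'))).filter
        (fun ab : ℕ × ℕ => ((g * m' * n' : ℕ) : ℤ) ∣ (ab.1 : ℤ) * n' - ab.2 * m' - r)).card : ℝ) ≤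
      g * ((∏ p ∈ g.primeFactors, (1 - 1 / (p:ℝ))) *
      (∏ p ∈ g.primeFactors.filter (fun p => ¬ p ∣ m' * n'), (1 - 1 / (p:ℝ)))) *
      pvF (m' * n') r.natAbs := by
  classical
  set T := (((Icc 1 (g*m')).filter (fun a => Nat.Coprime a (g*m')) ×ˢ
      (Icc 1 (g*n')).filter (fun b => Nat.Coprime b (g*n'))).filter
        (fun ab : ℕ × ℕ => ((g * m' * n' : ℕ) : ℤ) ∣ (ab.1 : ℤ) * n' - ab.2 * m' - r)) with hT
  have hmemT : ∀ a b : ℕ, (a, b) ∈ T → (1 ≤ a ∧ a ≤ g * m') ∧ a.Coprime (g*m') ∧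
      (1 ≤ b ∧ b ≤ g * n') ∧ b.Coprime (g*n') ∧
      ((g * m' * n' : ℕ) : ℤ) ∣ (a : ℤ) * n' - b * m' - r := by
    intro a b h
    simp only [hT, mem_filter, mem_product, mem_Icc] at h
    exact ⟨h.1.1.1, h.1.1.2, h.1.2.1, h.1.2.2, h.2⟩
  have hW : 0 ≤ (∏ p ∈ g.primeFactors, (1 - 1 / (p:ℝ))) *
      (∏ p ∈ g.primeFactors.filter (fun p => ¬ p ∣ m' * n'), (1 - 1 / (p:ℝ))) := by
    apply mul_nonneg <;> apply prod_nonneg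
    · intro p hp
      exact (pv_pos (Nat.prime_of_mem_primeFactors hp)).le
    · intro p hp
      exact (pv_pos (Nat.prime_of_mem_primeFactors (mem_filter.1 hp).1)).le
  rcases T.eq_empty_or_nonempty with hE | ⟨⟨a0, b0⟩, h0⟩
  · rw [hE]
    have := pvF_nonneg (m' * n') r.natAbs
    simp only [card_empty, Nat.cast_zero]
    positivity
  obtain ⟨ha0, hac, hb0, hbc, hd0⟩ := hmemT a0 b0 h0
  -- coprimality facts
  have hnot : ∀ (p x y : ℕ), p.Prime → x.Coprime y → p ∣ y → ¬ p ∣ x := by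
    intro p x y hp hxy hy hx
    exact hp.one_lt.ne' (Nat.eq_one_of_dvd_coprimes hxy hx hy)
  have hrcop : r.natAbs.Coprime (m' * n') := by
    apply Nat.Coprime.symm
    apply Nat.coprime_of_dvd
    intro p hp hpP hpr
    have hpr' : (p:ℤ) ∣ r := Int.natCast_dvd.2 hpr
    have hpI : Prime (p:ℤ) := Nat.prime_iff_prime_int.1 hp
    rcases (Nat.Prime.dvd_mul hp).1 hpP with h | h
    · have hpm : (p:ℤ) ∣ m' := by exact_mod_cast h
      have h2 : (p:ℤ) ∣ (a0 : ℤ) * n' - b0 * m' - r :=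
        dvd_trans (by push_cast; exact (hpm.mul_left _).mul_right _) hd0
      have h3 : (p:ℤ) ∣ (a0:ℤ) * n' := by
        have : (a0:ℤ) * n' = ((a0 : ℤ) * n' - b0 * m' - r) + b0 * m' + r := by ring
        rw [this]
        exact dvd_add (dvd_add h2 (hpm.mul_left _)) hpr'
      have h4 : p ∣ a0 * n' := by exact_mod_cast h3
      rcases (Nat.Prime.dvd_mul hp).1 h4 with h5 | h5
      · exact hnot p a0 _ hp hac (h.mul_left g) h5
      · exact hnot p m' n' hp hco h5 h
    · have hpm : (p:ℤ) ∣ n' := by exact_mod_cast h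
      have h2 : (p:ℤ) ∣ (a0 : ℤ) * n' - b0 * m' - r :=
        dvd_trans (by push_cast; exact hpm.mul_left _) hd0
      have h3 : (p:ℤ) ∣ (b0:ℤ) * m' := by
        have : (b0:ℤ) * m' = a0 * n' - ((a0 : ℤ) * n' - b0 * m' - r) - r := by ring
        rw [this]
        exact dvd_sub (dvd_sub (hpm.mul_left _) h2) hpr'
      have h4 : p ∣ b0 * m' := by exact_mod_cast h3
      rcases (Nat.Prime.dvd_mul hp).1 h4 with h5 | h5
      · exact hnot p b0 _ hp hbc (h.mul_left g) h5
      · exact hnot p m' n' hp hco h h5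
  have hr0 : r.natAbs ≠ 0 := by
    intro h
    rw [h, Nat.coprime_zero_left] at hrcop
    exact h1 hrcop
  rw [pvF_apply, if_pos hrcop]
  have : NeZero g := ⟨hg.ne'⟩
  have hcrt := pv_crt (G := ZMod g) g.primeFactors (fun p x => (x.cast : ZMod p))
    (fun p => {x : ZMod p | (a0 : ZMod p) + m' * x = 0 ∨ (b0 : ZMod p) + n' * x = 0})
    (fun p => if p ∣ m' * n' ∨ p ∣ r.natAbs then (1:ℝ) else 2)
    (by
      intro p hp x y
      exact ZMod.cast_add (Nat.dvd_of_mem_primeFactors hp) x y)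
    (by
      intro p hp
      have hpp := Nat.prime_of_mem_primeFactors hp
      have : Fact p.Prime := ⟨hpp⟩
      refine ⟨(((∏ q ∈ g.primeFactors.erase p, q) ^ (p - 1) : ℕ) : ZMod g), ?_, ?_⟩
      · rw [ZMod.cast_natCast (Nat.dvd_of_mem_primeFactors hp), Nat.cast_pow]
        apply ZMod.pow_card_sub_one_eq_one
        rw [Ne, ZMod.natCast_eq_zero_iff, Prime.dvd_finsetProd_iff hpp.prime]
        rintro ⟨q, hq, hpq⟩
        rw [mem_erase] at hq
        exact hq.1 ((Nat.prime_dvd_prime_iff_eq hpp (Nat.prime_of_mem_primeFactors hq.2)).1 hpq).symm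
      · intro q hq hqp
        rw [ZMod.cast_natCast (Nat.dvd_of_mem_primeFactors hq), ZMod.natCast_eq_zero_iff]
        apply Dvd.dvd.pow
        · exact dvd_prod_of_mem _ (mem_erase.2 ⟨hqp, hq⟩)
        · have := hpp.two_le; omega)
    (fun p hp => Nat.prime_of_mem_primeFactors hp)
    (by
      intro p hp
      have hpp := Nat.prime_of_mem_primeFactors hp
      have hpg := Nat.dvd_of_mem_primeFactors hp
      have : Fact p.Prime := ⟨hpp⟩
      have : NeZero p := ⟨hpp.ne_zero⟩
      have hx1 : ¬ p ∣ m' → (a0 : ZMod p) + m' * (-(a0 : ZMod p) / m') = 0 := by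
        intro h
        have : (m' : ZMod p) ≠ 0 := by rwa [Ne, ZMod.natCast_eq_zero_iff]
        rw [mul_div_cancel₀ _ this]; ring
      have hx2 : ¬ p ∣ n' → (b0 : ZMod p) + n' * (-(b0 : ZMod p) / n') = 0 := by
        intro h
        have : (n' : ZMod p) ≠ 0 := by rwa [Ne, ZMod.natCast_eq_zero_iff]
        rw [mul_div_cancel₀ _ this]; ring
      split_ifs with hif
      · have : 0 < ({x : ZMod p | (a0 : ZMod p) + m' * x = 0 ∨
            (b0 : ZMod p) + n' * x = 0}).ncard := by
          rw [Set.ncard_pos (Set.toFinite _)]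
          by_cases hm : p ∣ m'
          · exact ⟨_, Or.inr (hx2 (fun h => hnot p m' n' hpp hco h hm))⟩
          · exact ⟨_, Or.inl (hx1 hm)⟩
        exact_mod_cast this
      · rw [not_or] at hif
        have hm : ¬ p ∣ m' := fun h => hif.1 (h.mul_right _)
        have hn : ¬ p ∣ n' := fun h => hif.1 (h.mul_left _)
        have hm0 : (m' : ZMod p) ≠ 0 := by rwa [Ne, ZMod.natCast_eq_zero_iff]
        have hn0 : (n' : ZMod p) ≠ 0 := by rwa [Ne, ZMod.natCast_eq_zero_iff]
        have hne : (-(a0 : ZMod p) / m') ≠ (-(b0 : ZMod p) / n') := by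
          intro h
          rw [div_eq_div_iff hm0 hn0] at h
          apply hif.2
          rw [← Int.natCast_dvd, ← ZMod.intCast_zmod_eq_zero_iff_dvd]
          have h2 : (p:ℤ) ∣ (a0 : ℤ) * n' - b0 * m' - r := by
            refine dvd_trans ?_ hd0
            have : p ∣ g * m' * n' := (hpg.mul_right _).mul_right _
            exact_mod_cast this
          rw [← ZMod.intCast_zmod_eq_zero_iff_dvd] at h2
          push_cast at h2
          linear_combination -h2 - h
        have h2 := Set.ncard_le_ncard (s := {(-(a0 : ZMod p) / m'), (-(b0 : ZMod p) / n')})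
          (t := {x : ZMod p | (a0 : ZMod p) + m' * x = 0 ∨ (b0 : ZMod p) + n' * x = 0})
          (by
            rintro x (rfl | rfl)
            · exact Or.inl (hx1 hm)
            · exact Or.inr (hx2 hn)) (Set.toFinite _)
        rw [Set.ncard_pair hne] at h2
        exact_mod_cast h2)
  rw [ZMod.card] at hcrt
  have hinj : T.card ≤ ((Finset.univ : Finset (ZMod g)).filter (fun x => ∀ p ∈ g.primeFactors,
      (x.cast : ZMod p) ∉ {x : ZMod p | (a0 : ZMod p) + m' * x = 0 ∨
        (b0 : ZMod p) + n' * x = 0})).card := by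
    have hstruct : ∀ a b : ℕ, (a, b) ∈ T → ∃ s t : ℤ, (a:ℤ) - a0 = m' * s ∧ (b:ℤ) - b0 = n' * t ∧
        (g:ℤ) ∣ s - t := by
      intro a b hab
      obtain ⟨-, -, -, -, hd⟩ := hmemT a b hab
      have hdd := dvd_sub hd hd0
      have heq : ((a : ℤ) * n' - b * m' - r) - ((a0 : ℤ) * n' - b0 * m' - r) =
        ((a:ℤ) - a0) * n' - ((b:ℤ) - b0) * m' := by ring
      rw [heq] at hdd
      push_cast at hdd
      have hcoZ : IsCoprime (m':ℤ) (n':ℤ) := Nat.isCoprime_iff_coprime.2 hco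
      have hs : (m':ℤ) ∣ (a:ℤ) - a0 := by
        apply hcoZ.dvd_of_dvd_mul_right
        have h2 : (m':ℤ) ∣ ((a:ℤ) - a0) * n' - ((b:ℤ) - b0) * m' :=
          dvd_trans ⟨g * n', by ring⟩ hdd
        exact (dvd_sub_left (dvd_mul_left _ _)).1 h2
      have ht : (n':ℤ) ∣ (b:ℤ) - b0 := by
        apply hcoZ.symm.dvd_of_dvd_mul_right
        have h2 : (n':ℤ) ∣ ((a:ℤ) - a0) * n' - ((b:ℤ) - b0) * m' :=
          dvd_trans ⟨g * m', by ring⟩ hdd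
        exact (dvd_sub_right (dvd_mul_left _ _)).1 h2
      obtain ⟨s, hs⟩ := hs
      obtain ⟨t, ht⟩ := ht
      refine ⟨s, t, hs, ht, ?_⟩
      rw [hs, ht] at hdd
      have h3 : (m':ℤ) * s * n' - n' * t * m' = (s - t) * (m' * n') := by ring
      rw [h3, mul_assoc] at hdd
      exact Int.dvd_of_mul_dvd_mul_right (by positivity) hdd
    choose! s t hs ht hst using hstruct
    apply Finset.card_le_card_of_injOn (fun ab => ((s ab.1 ab.2 : ℤ) : ZMod g))
    · rintro ⟨a, b⟩ hab
      have hab : (a, b) ∈ T := hab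
      obtain ⟨ha, hac', hb, hbc', -⟩ := hmemT a b hab
      simp only [Finset.coe_filter, Finset.mem_univ, true_and, Set.mem_ofPred_eq]
      intro p hp
      have hpp := Nat.prime_of_mem_primeFactors hp
      have hpg := Nat.dvd_of_mem_primeFactors hp
      rw [ZMod.cast_intCast hpg]
      have e1 : (a : ZMod p) - a0 = m' * (s a b : ZMod p) := by
        have := congrArg (Int.cast : ℤ → ZMod p) (hs a b hab)
        push_cast at this; exact this
      have e2 : (b : ZMod p) - b0 = n' * (t a b : ZMod p) := by
        have := congrArg (Int.cast : ℤ → ZMod p) (ht a b hab)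
        push_cast at this; exact this
      have e3 : (s a b : ZMod p) - t a b = 0 := by
        have : (p:ℤ) ∣ s a b - t a b := dvd_trans (by exact_mod_cast hpg) (hst a b hab)
        rw [← ZMod.intCast_zmod_eq_zero_iff_dvd] at this
        push_cast at this; exact this
      rintro (h | h)
      · have : (a : ZMod p) = 0 := by linear_combination e1 + h
        rw [ZMod.natCast_eq_zero_iff] at this
        exact hnot p a _ hpp hac' (hpg.mul_right _) this
      · have : (b : ZMod p) = 0 := by linear_combination e2 + h - n' * e3
        rw [ZMod.natCast_eq_zero_iff] at this
        exact hnot p b _ hpp hbc' (hpg.mul_right _) this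
    · rintro ⟨a, b⟩ hab ⟨a', b'⟩ hab' heq
      have hab : (a, b) ∈ T := hab
      have hab' : (a', b') ∈ T := hab'
      obtain ⟨ha, -, hb, -, -⟩ := hmemT a b hab
      obtain ⟨ha', -, hb', -, -⟩ := hmemT a' b' hab'
      have hgs : (g:ℤ) ∣ s a b - s a' b' := by
        have heq : ((s a b : ℤ) : ZMod g) = ((s a' b' : ℤ) : ZMod g) := heq
        rw [← ZMod.intCast_zmod_eq_zero_iff_dvd]
        push_cast; rw [heq]; ring
      have hgt : (g:ℤ) ∣ t a b - t a' b' := by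
        have e : t a b - t a' b' = (s a b - s a' b') - (s a b - t a b) + (s a' b' - t a' b') := by
          ring
        rw [e]
        exact dvd_add (dvd_sub hgs (hst a b hab)) (hst a' b' hab')
      have haux : ∀ (M x y : ℕ), 1 ≤ x ∧ x ≤ M → 1 ≤ y ∧ y ≤ M → (M:ℤ) ∣ (x:ℤ) - y → x = y := by
        intro M x y hx hy hd
        have hlt : |(x:ℤ) - y| < M := by
          rw [abs_lt]; constructor <;> omega
        have := Int.eq_zero_of_abs_lt_dvd hd hlt
        omega
      have h2 : a = a' := by
        apply haux (g*m') a a' ha ha'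
        have e : (a:ℤ) - a' = (s a b - s a' b') * m' := by
          linear_combination hs a b hab - hs a' b' hab'
        rw [e]; push_cast
        exact mul_dvd_mul_right hgs _
      have h3 : b = b' := by
        apply haux (g*n') b b' hb hb'
        have e : (b:ℤ) - b' = (t a b - t a' b') * n' := by
          linear_combination ht a b hab - ht a' b' hab'
        rw [e]; push_cast
        exact mul_dvd_mul_right hgt _
      rw [h2, h3]
  have hinj' := (Nat.cast_le (α := ℝ)).2 hinj
  refine hinj'.trans (le_trans (le_trans (le_of_eq ?_) hcrt) ?_)
  · congr
  · rw [mul_assoc]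
    exact mul_le_mul_of_nonneg_left (pv_local g (m' * n') r.natAbs hr0) (by positivity)

end counting

section measure

/-- the arc attached to `a / n` -/
noncomputable def pvArc (ψ : ℕ → ℝ) (n a : ℕ) : Set UnitAddCircle :=
  (fun y : ℝ => (y : UnitAddCircle)) '' Set.Ioo (((a : ℝ) - ψ n) / n) (((a : ℝ) + ψ n) / n)

lemma pvArc_isOpen (ψ : ℕ → ℝ) (n a : ℕ) : IsOpen (pvArc ψ n a) :=
  QuotientAddGroup.isOpenMap_coe _ isOpen_Ioo

lemma pvArc_vol_le (ψ : ℕ → ℝ) (n a : ℕ) (hn : 0 < n) (h : 0 ≤ ψ n) :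
    volume (pvArc ψ n a) ≤ ENNReal.ofReal (2 * (ψ n / n)) := by
  have hn' : (0:ℝ) < n := by exact_mod_cast hn
  have hsub : pvArc ψ n a ⊆ Metric.closedBall (((a:ℝ)/n : ℝ) : UnitAddCircle) (ψ n / n) := by
    rintro _ ⟨y, hy, rfl⟩
    rw [Metric.mem_closedBall, dist_eq_norm]
    change ‖((y : ℝ) : UnitAddCircle) - (((a:ℝ)/n : ℝ) : UnitAddCircle)‖ ≤ _
    rw [← AddCircle.coe_sub]
    refine (QuotientAddGroup.norm_mk_le_norm).trans ?_
    rw [Real.norm_eq_abs, abs_le]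
    rw [sub_div, add_div] at hy
    constructor <;> linarith [hy.1, hy.2]
  refine (measure_mono hsub).trans ?_
  rw [AddCircle.volume_closedBall]
  exact ENNReal.ofReal_le_ofReal (min_le_right _ _)

lemma pvE_lower (ψ : ℕ → ℝ) (n : ℕ) (hn : 0 < n) (h0 : 0 < ψ n) (h1 : ψ n ≤ 1/2) :
    2 * ψ n * ((Nat.totient n : ℝ) / n) ≤ (volume (E ψ n)).toReal := by
  have hn' : (0:ℝ) < n := by exact_mod_cast hn
  set S := (Finset.Icc 1 n).filter (fun a => Nat.Coprime a n) with hS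
  have hcard : S.card = Nat.totient n := by
    have := Nat.filter_coprime_Ico_eq_totient n 1
    rw [← this]
    congr 1
    ext a
    simp only [hS, mem_filter, mem_Icc, mem_Ico, Nat.coprime_comm (n := n)]
    constructor
    · rintro ⟨h, h'⟩; exact ⟨by omega, h'⟩
    · rintro ⟨h, h'⟩; exact ⟨by omega, h'⟩
  have hopen : IsOpen (E ψ n) := by
    apply isOpen_biUnion
    intro a _
    exact pvArc_isOpen ψ n a
  have hmeas := hopen.measurableSet
  have hv := AddCircle.add_projection_respects_measure (1:ℝ) (1/(2*(n:ℝ))) hmeas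
  set I : ℕ → Set ℝ := fun a => Set.Ioo (((a : ℝ) - ψ n) / n) (((a : ℝ) + ψ n) / n) with hI
  have hsub : (⋃ a ∈ S, I a) ⊆ (QuotientAddGroup.mk ⁻¹' (E ψ n)) ∩
      (Set.Ioc (1/(2*(n:ℝ))) (1/(2*(n:ℝ)) + 1)) := by
    intro y hy
    simp only [Set.mem_iUnion] at hy
    obtain ⟨a, haS, hy⟩ := hy
    refine ⟨?_, ?_⟩
    · simp only [Set.mem_preimage, E, Set.mem_iUnion]
      exact ⟨a, haS, y, hy, rfl⟩
    · simp only [hS, mem_filter, mem_Icc] at haS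
      have ha1 : (1:ℝ) ≤ a := by exact_mod_cast haS.1.1
      have ha2 : (a:ℝ) ≤ n := by exact_mod_cast haS.1.2
      simp only [hI, Set.mem_Ioo] at hy
      rw [div_lt_iff₀ hn', lt_div_iff₀ hn'] at hy
      constructor
      · rw [div_lt_iff₀ (by positivity)]
        nlinarith [hy.1]
      · have : 1/(2*(n:ℝ)) + 1 = (1/2 + n) / n := by field_simp
        rw [this, le_div_iff₀ hn']
        linarith [hy.2]
  have hdisj : (S : Set ℕ).PairwiseDisjoint I := by
    have haux : ∀ a b : ℕ, a < b → Disjoint (I a) (I b) := by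
      intro a b hab
      rw [Set.disjoint_left]
      rintro y hy hy'
      simp only [hI, Set.mem_Ioo] at hy hy'
      have h2 := hy.2
      have h3 := hy'.1
      rw [lt_div_iff₀ hn'] at h2
      rw [div_lt_iff₀ hn'] at h3
      have : (a:ℝ) + 1 ≤ b := by exact_mod_cast hab
      linarith
    intro a _ b _ hab
    rcases lt_or_gt_of_ne hab with h | h
    · exact haux a b h
    · exact (haux b a h).symm
  have hvol : volume (⋃ a ∈ S, I a) = ENNReal.ofReal (2 * ψ n * ((Nat.totient n : ℝ) / n)) := by
    rw [measure_biUnion_finset hdisj (fun a _ => measurableSet_Ioo)]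
    have : ∀ a ∈ S, volume (I a) = ENNReal.ofReal (2 * (ψ n / n)) := by
      intro a _
      simp only [hI, Real.volume_Ioo]
      congr 1
      ring
    rw [sum_congr rfl this, sum_const, nsmul_eq_mul, hcard, ← ENNReal.ofReal_natCast,
      ← ENNReal.ofReal_mul (by positivity)]
    congr 1
    ring
  have hfin : volume (E ψ n) ≠ ⊤ := measure_ne_top _ _
  rw [← ENNReal.ofReal_le_iff_le_toReal hfin, ← hvol, hv]
  exact measure_mono hsub

lemma pv_arc_meet (ψ : ℕ → ℝ) (m n a b g m' n' : ℕ) (hg : 0 < g) (hm : 0 < m') (hn : 0 < n')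
    (em : m = g * m') (en : n = g * n') (D : ℝ) (hD1 : n * ψ m ≤ D * g) (hD2 : m * ψ n ≤ D * g)
    (h : (pvArc ψ m a ∩ pvArc ψ n b).Nonempty) :
    ∃ r ∈ Finset.Icc (-(⌊2 * D⌋₊ : ℤ)) ⌊2 * D⌋₊,
      ((g * m' * n' : ℕ) : ℤ) ∣ (a : ℤ) * n' - b * m' - r := by
  obtain ⟨x, ⟨y, hy, rfl⟩, ⟨z, hz, hyz⟩⟩ := h
  have hyz : ((z:ℝ) : AddCircle (1:ℝ)) = ((y:ℝ) : AddCircle (1:ℝ)) := hyz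
  rw [← sub_eq_zero, ← AddCircle.coe_sub, AddCircle.coe_eq_zero_iff] at hyz
  obtain ⟨k, hk⟩ := hyz
  rw [zsmul_eq_mul, mul_one] at hk
  have hg' : (0:ℝ) < g := by exact_mod_cast hg
  have hm' : (0:ℝ) < m := by
    rw [em]; exact_mod_cast Nat.mul_pos hg hm
  have hn' : (0:ℝ) < n := by
    rw [en]; exact_mod_cast Nat.mul_pos hg hn
  rw [Set.mem_Ioo, div_lt_iff₀ hm', lt_div_iff₀ hm'] at hy
  rw [Set.mem_Ioo, div_lt_iff₀ hn', lt_div_iff₀ hn'] at hz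
  set r : ℤ := a * n' - b * m' + k * (g * m' * n') with hr
  have hgr : (g:ℝ) * r = (a - y * m) * n - (b - z * n) * m := by
    have e1 : z = k + y := by linarith
    have em' : (m:ℝ) = g * m' := by exact_mod_cast em
    have en' : (n:ℝ) = g * n' := by exact_mod_cast en
    rw [hr, e1, em', en']
    push_cast
    ring
  have hlt1 : (g:ℝ) * r < g * (2 * D) := by
    rw [hgr]
    nlinarith [mul_lt_mul_of_pos_right hy.1 hn', mul_lt_mul_of_pos_right hz.2 hm']
  have hlt2 : (g:ℝ) * (-r) < g * (2 * D) := by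
    rw [mul_neg, hgr]
    nlinarith [mul_lt_mul_of_pos_right hy.2 hn', mul_lt_mul_of_pos_right hz.1 hm']
  have h1 := lt_of_mul_lt_mul_left hlt1 hg'.le
  have h2 := lt_of_mul_lt_mul_left hlt2 hg'.le
  have h3 : r.natAbs ≤ ⌊2 * D⌋₊ := by
    apply Nat.le_floor
    rw [Nat.cast_natAbs, Int.cast_abs, abs_le]
    constructor <;> linarith
  refine ⟨r, ?_, ⟨-k, ?_⟩⟩
  · rw [Finset.mem_Icc]; omega
  · rw [hr]; push_cast; ring

end measure

lemma pv_sum_sym (f : ℕ → ℝ) (h0 : f 0 = 0) (N : ℕ) :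
    ∑ r ∈ Finset.Icc (-(N : ℤ)) N, f r.natAbs = 2 * ∑ r ∈ Ioc 0 N, f r := by
  induction N with
  | zero => simp [h0]
  | succ N ih =>
    have : Finset.Icc (-((N+1 : ℕ) : ℤ)) ((N+1 : ℕ) : ℤ) =
        insert (-((N+1 : ℕ) : ℤ)) (insert ((N+1 : ℕ) : ℤ) (Finset.Icc (-(N : ℤ)) N)) := by
      ext x
      simp only [Finset.mem_insert, Finset.mem_Icc]
      omega
    rw [this, sum_insert, sum_insert, ih,
      ← Finset.insert_Ioc_right_eq_Ioc_add_one (by omega : 0 ≤ N), sum_insert (by simp)]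
    · rw [Int.natAbs_neg, Int.natAbs_natCast]; ring
    · simp
    · simp only [Finset.mem_insert, Finset.mem_Icc]
      omega

lemma pv_W (g m' n' : ℕ) (hg : 0 < g) (hm : 0 < m') (hn : 0 < n') (hco : m'.Coprime n') :
    ((Nat.totient (g*m') : ℝ) / (g*m' : ℕ)) * ((Nat.totient (g*n') : ℝ) / (g*n' : ℕ)) =
    ((∏ p ∈ g.primeFactors, (1 - 1 / (p:ℝ))) *
      (∏ p ∈ g.primeFactors.filter (fun p => ¬ p ∣ m' * n'), (1 - 1 / (p:ℝ)))) *
      ∏ p ∈ (m' * n').primeFactors, (1 - 1 / (p:ℝ)) := by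
  rw [pv_totient_ratio _ (Nat.mul_pos hg hm).ne', pv_totient_ratio _ (Nat.mul_pos hg hn).ne',
    ← prod_union_inter]
  have h1 : (g*m').primeFactors ∩ (g*n').primeFactors = g.primeFactors := by
    rw [← Nat.primeFactors_gcd (Nat.mul_pos hg hm).ne' (Nat.mul_pos hg hn).ne',
      Nat.gcd_mul_left, hco.gcd_eq_one, mul_one]
  have h2 : (g*m').primeFactors ∪ (g*n').primeFactors =
      g.primeFactors.filter (fun p => ¬ p ∣ m' * n') ∪ (m' * n').primeFactors := by
    ext p
    simp only [Finset.mem_union, mem_filter, Nat.mem_primeFactors, ne_eq]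
    have := Nat.mul_pos hg hm
    have := Nat.mul_pos hg hn
    have := Nat.mul_pos hm hn
    constructor
    · rintro (⟨hp, hd, -⟩ | ⟨hp, hd, -⟩)
      · by_cases h : p ∣ m' * n'
        · exact Or.inr ⟨hp, h, by omega⟩
        · refine Or.inl ⟨⟨hp, ?_, by omega⟩, h⟩
          exact (hp.dvd_mul.1 hd).resolve_right (fun h' => h (h'.mul_right _))
      · by_cases h : p ∣ m' * n'
        · exact Or.inr ⟨hp, h, by omega⟩
        · refine Or.inl ⟨⟨hp, ?_, by omega⟩, h⟩
          exact (hp.dvd_mul.1 hd).resolve_right (fun h' => h (h'.mul_left _))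
    · rintro (⟨⟨hp, hd, -⟩, -⟩ | ⟨hp, hd, -⟩)
      · exact Or.inl ⟨hp, hd.mul_right _, by omega⟩
      · rcases hp.dvd_mul.1 hd with h | h
        · exact Or.inl ⟨hp, h.mul_left _, by omega⟩
        · exact Or.inr ⟨hp, h.mul_left _, by omega⟩
  have h3 : Disjoint (g.primeFactors.filter (fun p => ¬ p ∣ m' * n')) (m' * n').primeFactors := by
    rw [Finset.disjoint_left]
    intro p hp hp'
    exact (mem_filter.1 hp).2 (Nat.dvd_of_mem_primeFactors hp')
  rw [h1, h2, prod_union h3]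
  ring

/-- Overlap estimate of Pollington and Vaughan. -/
theorem pollington_vaughan :
    ∃ C : ℝ, 0 < C ∧ ∀ (ψ : ℕ → ℝ), (∀ n, 0 ≤ ψ n) → ∀ m n : ℕ, 0 < m → 0 < n → m ≠ n →
      0 < ψ m → ψ m ≤ 1 / 2 → 0 < ψ n → ψ n ≤ 1 / 2 →
      (volume (E ψ m ∩ E ψ n)).toReal /
          ((volume (E ψ m)).toReal * (volume (E ψ n)).toReal) ≤
        C * ∏ p ∈ ((m * n / Nat.gcd m n ^ 2).primeFactors.filter
            (fun p : ℕ => (p : ℝ) > max ((n : ℝ) * ψ m) ((m : ℝ) * ψ n) / Nat.gcd m n)),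
          (1 - 1 / (p : ℝ))⁻¹ := by
  obtain ⟨C0, hC0, hsieve⟩ := pv_sieve
  refine ⟨2 * C0, by positivity, ?_⟩
  intro ψ hψ m n hm hn hmn hm0 hm1 hn0 hn1
  obtain ⟨g, hgdef⟩ : ∃ g, g = Nat.gcd m n := ⟨_, rfl⟩
  have hg : 0 < g := hgdef ▸ Nat.gcd_pos_of_pos_left n hm
  obtain ⟨m', em⟩ : g ∣ m := hgdef ▸ Nat.gcd_dvd_left m n
  obtain ⟨n', en⟩ : g ∣ n := hgdef ▸ Nat.gcd_dvd_right m n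
  have hm' : 0 < m' := by
    rcases Nat.eq_zero_or_pos m' with h | h
    · subst h; omega
    · exact h
  have hn' : 0 < n' := by
    rcases Nat.eq_zero_or_pos n' with h | h
    · subst h; omega
    · exact h
  have hco : m'.Coprime n' := by
    have h : g * 1 = g * Nat.gcd m' n' := by
      rw [← Nat.gcd_mul_left, ← em, ← en, mul_one]; exact hgdef
    exact (Nat.eq_of_mul_eq_mul_left hg h).symm
  have hP1 : m' * n' ≠ 1 := by
    intro h
    have h1 := Nat.eq_one_of_mul_eq_one_right h
    have h2 := Nat.eq_one_of_mul_eq_one_left h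
    apply hmn
    rw [em, en, h1, h2]
  have hPeq : m * n / Nat.gcd m n ^ 2 = m' * n' := by
    rw [← hgdef]
    apply Nat.div_eq_of_eq_mul_right (by positivity)
    rw [em, en]; ring
  rw [hPeq, ← hgdef]
  set D : ℝ := max ((n : ℝ) * ψ m) ((m : ℝ) * ψ n) / g with hD
  have hgR : (0:ℝ) < g := by exact_mod_cast hg
  have hmR : (0:ℝ) < m := by exact_mod_cast hm
  have hnR : (0:ℝ) < n := by exact_mod_cast hn
  have hDg : D * g = max ((n : ℝ) * ψ m) ((m : ℝ) * ψ n) := by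
    rw [hD, div_mul_cancel₀ _ hgR.ne']
  have hD1 : n * ψ m ≤ D * g := hDg ▸ le_max_left _ _
  have hD2 : m * ψ n ≤ D * g := hDg ▸ le_max_right _ _
  have hD0 : 0 < D := by
    have : 0 < D * g := lt_of_lt_of_le (by positivity) hD1
    exact pos_of_mul_pos_left this hgR.le
  have hW := pv_W g m' n' hg hm' hn' hco
  rw [← em, ← en] at hW
  set W0 := (∏ p ∈ g.primeFactors, (1 - 1 / (p:ℝ))) *
      (∏ p ∈ g.primeFactors.filter (fun p => ¬ p ∣ m' * n'), (1 - 1 / (p:ℝ))) with hW0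
  have hW0nn : 0 ≤ W0 := by
    apply mul_nonneg <;> apply prod_nonneg
    · intro p hp
      exact (pv_pos (Nat.prime_of_mem_primeFactors hp)).le
    · intro p hp
      exact (pv_pos (Nat.prime_of_mem_primeFactors (mem_filter.1 hp).1)).le
  set P := m' * n' with hP
  set N := ⌊2 * D⌋₊ with hN
  set R := ∏ p ∈ P.primeFactors.filter (fun p : ℕ => (p:ℝ) > D), (1 - 1 / (p:ℝ)) with hR
  set Q := ∏ p ∈ P.primeFactors.filter (fun p : ℕ => ¬ (p:ℝ) > D), (1 - 1 / (p:ℝ)) with hQ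
  have hRpos : 0 < R := by
    apply prod_pos
    intro p hp
    exact pv_pos (Nat.prime_of_mem_primeFactors (mem_filter.1 hp).1)
  have hQpos : 0 < Q := by
    apply prod_pos
    intro p hp
    exact pv_pos (Nat.prime_of_mem_primeFactors (mem_filter.1 hp).1)
  have hRQ : ∏ p ∈ P.primeFactors, (1 - 1 / (p:ℝ)) = R * Q :=
    (prod_filter_mul_prod_filter_not _ _ _).symm
  -- the sieve bound
  have hS : ∑ r ∈ Ioc 0 N, pvF P r ≤ C0 * (2 * D * Q) := by
    rcases Nat.eq_zero_or_pos N with h | h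
    · rw [h]; simp; positivity
    · refine (hsieve P N (Nat.mul_pos hm' hn') h).trans ?_
      have h1 : (N:ℝ) ≤ 2 * D := Nat.floor_le (by positivity)
      have h2 : ∏ p ∈ P.primeFactors.filter (fun p => p ≤ N), (1 - 1 / (p:ℝ)) ≤ Q := by
        have hsub : P.primeFactors.filter (fun p : ℕ => ¬ (p:ℝ) > D) ⊆
            P.primeFactors.filter (fun p => p ≤ N) := by
          intro p hp
          rw [mem_filter] at hp ⊢
          refine ⟨hp.1, Nat.le_floor ?_⟩
          have := not_lt.1 hp.2
          linarith
        rw [← prod_sdiff hsub]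
        apply mul_le_of_le_one_left hQpos.le
        apply Finset.prod_le_one
        · intro p hp
          exact (pv_pos (Nat.prime_of_mem_primeFactors
            (mem_filter.1 (mem_sdiff.1 hp).1).1)).le
        · intro p hp
          have : (0:ℝ) ≤ 1 / p := by positivity
          linarith
      gcongr
      exact prod_nonneg fun p hp =>
        (pv_pos (Nat.prime_of_mem_primeFactors (mem_filter.1 hp).1)).le
  -- the overlap
  set Sm := (Finset.Icc 1 m).filter (fun a => Nat.Coprime a m) with hSm
  set Sn := (Finset.Icc 1 n).filter (fun a => Nat.Coprime a n) with hSn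
  set δ := min (ψ m / m) (ψ n / n) with hδ
  have hδ0 : 0 ≤ δ := le_min (by positivity) (by positivity)
  classical
  set F := (Sm ×ˢ Sn).filter
    (fun ab : ℕ × ℕ => (pvArc ψ m ab.1 ∩ pvArc ψ n ab.2).Nonempty) with hF
  have hcov : E ψ m ∩ E ψ n ⊆ ⋃ ab ∈ F, (pvArc ψ m ab.1 ∩ pvArc ψ n ab.2) := by
    rintro x ⟨hx1, hx2⟩
    simp only [E, Set.mem_iUnion] at hx1 hx2
    obtain ⟨a, ha, hxa⟩ := hx1
    obtain ⟨b, hb, hxb⟩ := hx2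
    simp only [Set.mem_iUnion]
    refine ⟨(a, b), ?_, hxa, hxb⟩
    rw [hF, mem_filter, mem_product]
    exact ⟨⟨ha, hb⟩, ⟨x, hxa, hxb⟩⟩
  have hV : (volume (E ψ m ∩ E ψ n)).toReal ≤ F.card * (2 * δ) := by
    apply ENNReal.toReal_le_of_le_ofReal
      (mul_nonneg (Nat.cast_nonneg _) (mul_nonneg zero_le_two hδ0))
    calc volume (E ψ m ∩ E ψ n) ≤ ∑ ab ∈ F, volume (pvArc ψ m ab.1 ∩ pvArc ψ n ab.2) :=
          (measure_mono hcov).trans (measure_biUnion_finset_le _ _)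
      _ ≤ ∑ ab ∈ F, ENNReal.ofReal (2 * δ) := by
          apply sum_le_sum
          intro ab _
          rw [hδ]
          rcases min_cases (ψ m / m) (ψ n / n) with h | h
          · rw [h.1]
            exact (measure_mono Set.inter_subset_left).trans
              (pvArc_vol_le ψ m ab.1 hm (hψ m))
          · rw [h.1]
            exact (measure_mono Set.inter_subset_right).trans
              (pvArc_vol_le ψ n ab.2 hn (hψ n))
      _ = _ := by
          rw [sum_const, nsmul_eq_mul, ← ENNReal.ofReal_natCast,
            ← ENNReal.ofReal_mul (Nat.cast_nonneg _)]
  have hFsub : F ⊆ (Finset.Icc (-(N : ℤ)) N).biUnion (fun r => (Sm ×ˢ Sn).filter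
      (fun ab : ℕ × ℕ => ((g * m' * n' : ℕ) : ℤ) ∣ (ab.1 : ℤ) * n' - ab.2 * m' - r)) := by
    rintro ⟨a, b⟩ hab
    rw [hF, mem_filter] at hab
    obtain ⟨r, hr, hd⟩ := pv_arc_meet ψ m n a b g m' n' hg hm' hn' em en D hD1 hD2 hab.2
    rw [mem_biUnion]
    exact ⟨r, hr, mem_filter.2 ⟨hab.1, hd⟩⟩
  have hFcard : (F.card : ℝ) ≤ g * W0 * (2 * (C0 * (2 * D * Q))) := by
    calc (F.card : ℝ) ≤ ∑ r ∈ Finset.Icc (-(N : ℤ)) N, (((Sm ×ˢ Sn).filter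
          (fun ab : ℕ × ℕ => ((g * m' * n' : ℕ) : ℤ) ∣
            (ab.1 : ℤ) * n' - ab.2 * m' - r)).card : ℝ) := by
          exact_mod_cast (card_le_card hFsub).trans card_biUnion_le
      _ ≤ ∑ r ∈ Finset.Icc (-(N : ℤ)) N, g * W0 * pvF P r.natAbs := by
          apply sum_le_sum
          intro r _
          rw [hSm, hSn, em, en]
          exact pv_count_r g m' n' hg hm' hn' hco hP1 r
      _ = g * W0 * (2 * ∑ r ∈ Ioc 0 N, pvF P r) := by
          rw [← mul_sum, pv_sum_sym (fun r => pvF P r) (by simp)]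
      _ ≤ _ := by gcongr
  have hδD : δ * (D * g) ≤ ψ m * ψ n := by
    rw [hDg]
    rcases max_cases ((n : ℝ) * ψ m) ((m : ℝ) * ψ n) with h | h
    · rw [h.1]
      calc δ * (n * ψ m) ≤ (ψ n / n) * (n * ψ m) := by
            gcongr
            exact min_le_right _ _
        _ = _ := by field_simp
    · rw [h.1]
      calc δ * (m * ψ n) ≤ (ψ m / m) * (m * ψ n) := by
            gcongr
            exact min_le_left _ _
        _ = _ := by field_simp
  have hEm := pvE_lower ψ m hm hm0 hm1
  have hEn := pvE_lower ψ n hn hn0 hn1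
  have hden : 4 * (ψ m * ψ n) * (W0 * (R * Q)) ≤
      (volume (E ψ m)).toReal * (volume (E ψ n)).toReal := by
    calc _ = (2 * ψ m * ((Nat.totient m : ℝ) / m)) * (2 * ψ n * ((Nat.totient n : ℝ) / n)) := by
          rw [← hRQ, ← hW]; ring
      _ ≤ _ := mul_le_mul hEm hEn (by positivity) (by positivity)
  rw [prod_inv_distrib]
  change _ ≤ 2 * C0 * R⁻¹
  apply div_le_of_le_mul₀ (by positivity) (by positivity)
  calc _ ≤ (F.card : ℝ) * (2 * δ) := hV
    _ ≤ (g * W0 * (2 * (C0 * (2 * D * Q)))) * (2 * δ) := by gcongr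
    _ = (δ * (D * g)) * (8 * C0 * W0 * Q) := by ring
    _ ≤ (ψ m * ψ n) * (8 * C0 * W0 * Q) := by gcongr
    _ = 2 * C0 * R⁻¹ * (4 * (ψ m * ψ n) * (W0 * (R * Q))) := by
        field_simp
        ring
    _ ≤ _ := by gcongr
end
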